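/- arXiv:2210.02594 — 5 statements merged into one kernel-verified Lean document; each statement's English description precedes it below -/
import Mathlib

section
/- Let 𝓜⁽¹⁾ and 𝓜⁽²⁾ be two RMMDPs over the same 𝒮, 𝒜, 𝒵 and horizon H, with the same transition kernel T and initial distribution ν, having M₁ and M₂ latent contexts respectively, and let δ > 0. Set d := min(H, M₁ + M₂ − 1). Let X_d be the set of length-d state–action sequences x such that for every z ∈ 𝒵^d and every subset I ⊆ {1,…,d} one has |𝐌⁽¹⁾(x_I, z_I) − 𝐌⁽²⁾(x_I, z_I)| ≤ δ. Let E_tot be the set of length-H state–action sequences x₁,…,x_H such that for all indices 1 ≤ t₁ < … < t_d ≤ H the subsequence (x_{t₁},…,x_{t_d}) lies in X_d. Then for every subset E ⊆ E_tot and every history-dependent policy π: Σ_{τ : x_{1:H} ∈ E} |P⁽¹⁾_π(τ) − P⁽²⁾_π(τ)| ≤ (sup_{π'} P⁽¹⁾_{π'}(x_{1:H} ∈ E)) · (4HZ)^d · δ. -/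
open Finset

/-- A probability distribution on a finite type. -/
def IsDist {X : Type*} [Fintype X] (p : X → ℝ) : Prop :=
  (∀ x, 0 ≤ p x) ∧ ∑ x, p x = 1

/-- A history-dependent policy: each history (past state-action-reward triples together
with the current state) is assigned a probability distribution over actions. -/
def IsPolicy {S A Z : Type*} [Fintype A]
    (π : List ((S × A) × Z) → S → A → ℝ) : Prop :=
  ∀ hist s, (∀ a, 0 ≤ π hist s a) ∧ ∑ a, π hist s a = 1

/-- A latent reward model: for each context and state-action pair, a distribution on rewards. -/
def IsRewardModel {X Z : Type*} [Fintype Z] {M : ℕ}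
    (μ : Fin M → X → Z → ℝ) : Prop :=
  ∀ m x, (∀ z, 0 ≤ μ m x z) ∧ ∑ z, μ m x z = 1

/-- The mixture moment `𝐌(x_I, z_I) = Σ_m w_m Π_{i ∈ I} μ_m(x_i, z_i)`. -/
def momentOn {X Z : Type*} {M d : ℕ} (w : Fin M → ℝ) (μ : Fin M → X → Z → ℝ)
    (x : Fin d → X) (z : Fin d → Z) (I : Finset (Fin d)) : ℝ :=
  ∑ m, w m * ∏ i ∈ I, μ m (x i) (z i)

/-- Probability of a length-`H` trajectory `τ = ((s_t,a_t),r_t)_{t}` under a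
history-dependent policy `π` in an RMMDP with transitions `T`, initial distribution `ν`,
mixing weights `w` and reward models `μ`. -/
noncomputable def trajProb {S A Z : Type*} (H : ℕ)
    (T : S × A → S → ℝ) (ν : S → ℝ)
    (π : List ((S × A) × Z) → S → A → ℝ)
    {M : ℕ} (w : Fin M → ℝ) (μ : Fin M → S × A → Z → ℝ)
    (τ : Fin H → (S × A) × Z) : ℝ :=
  (if h : 0 < H then ν ((τ ⟨0, h⟩).1.1) else 1)
    * (∏ t : Fin H, if h : (t : ℕ) + 1 < H then T (τ t).1 ((τ ⟨(t : ℕ) + 1, h⟩).1.1) else 1)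
    * (∏ t : Fin H, π ((List.ofFn τ).take t.val) (τ t).1.1 (τ t).1.2)
    * momentOn w μ (fun t => (τ t).1) (fun t => (τ t).2) Finset.univ

/-- `P_π(x_{1:H} ∈ E)`: total probability of trajectories whose state-action part lies in `E`. -/
noncomputable def eventProb {S A Z : Type*} [Fintype S] [Fintype A] [Fintype Z]
    [DecidableEq S] [DecidableEq A] (H : ℕ)
    (T : S × A → S → ℝ) (ν : S → ℝ)
    (π : List ((S × A) × Z) → S → A → ℝ)
    {M : ℕ} (w : Fin M → ℝ) (μ : Fin M → S × A → Z → ℝ)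
    (E : Finset (Fin H → S × A)) : ℝ :=
  ∑ τ : Fin H → (S × A) × Z,
    if (fun t => (τ t).1) ∈ E then trajProb H T ν π w μ τ else 0

/-- `sup_π P_π(x_{1:H} ∈ E)`, supremum over all history-dependent policies. -/
noncomputable def supEventProb {S A Z : Type*} [Fintype S] [Fintype A] [Fintype Z]
    [DecidableEq S] [DecidableEq A] (H : ℕ)
    (T : S × A → S → ℝ) (ν : S → ℝ)
    {M : ℕ} (w : Fin M → ℝ) (μ : Fin M → S × A → Z → ℝ)
    (E : Finset (Fin H → S × A)) : ℝ :=
  ⨆ π : {p : List ((S × A) × Z) → S → A → ℝ // IsPolicy p},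
    eventProb H T ν π.1 w μ E

section Mixture

variable {X Z : Type*} [Fintype X] [Fintype Z] [DecidableEq X]

open Classical in
/-- The indicator that the outcome at each time `t` is given by the map `ω t`. -/
noncomputable def agreeIndicator {X Z : Type*} {n : ℕ} (ω : Fin n → X → Z)
    (τ : Fin n → X × Z) : ℝ :=
  if ∀ t, ω t (τ t).1 = (τ t).2 then 1 else 0

open Classical in
theorem agreeIndicator_cons {X Z : Type*} {n : ℕ} (g : X → Z) (ω : Fin n → X → Z)
    (τ : Fin (n + 1) → X × Z) :
    agreeIndicator (Fin.cons g ω : Fin (n + 1) → X → Z) τ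
      = (if g (τ 0).1 = (τ 0).2 then 1 else 0) * agreeIndicator ω (Fin.tail τ) := by
  simp only [agreeIndicator, Fin.forall_fin_succ, Fin.cons_zero, Fin.cons_succ, Fin.tail]
  by_cases h₀ : g (τ 0).1 = (τ 0).2 <;>
    by_cases h₁ : ∀ t : Fin n, ω t (τ t.succ).1 = (τ t.succ).2 <;>
    simp [h₀, h₁]

/-- `G` is dominated by a mixture, of total mass at most `c`, of the indicators `agreeIndicator ω`. -/
def IsMixtureBounded (n : ℕ) (G : (Fin n → X × Z) → ℝ) (c : ℝ) : Prop :=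
  ∃ ρ : (Fin n → X → Z) → ℝ, (∀ ω, 0 ≤ ρ ω) ∧ ∑ ω, ρ ω ≤ c ∧
    ∀ τ, G τ ≤ ∑ ω, ρ ω * agreeIndicator ω τ

theorem IsMixtureBounded.add {n : ℕ} {G G' : (Fin n → X × Z) → ℝ} {c c' : ℝ}
    (h : IsMixtureBounded n G c) (h' : IsMixtureBounded n G' c') :
    IsMixtureBounded n (fun τ => G τ + G' τ) (c + c') := by
  obtain ⟨ρ, h0, hs, hG⟩ := h
  obtain ⟨ρ', h0', hs', hG'⟩ := h'
  refine ⟨fun ω => ρ ω + ρ' ω, fun ω => add_nonneg (h0 ω) (h0' ω), ?_, fun τ => ?_⟩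
  · rw [sum_add_distrib]; exact add_le_add hs hs'
  · simp only [add_mul, sum_add_distrib]; exact add_le_add (hG τ) (hG' τ)

theorem IsMixtureBounded.mono {n : ℕ} {G : (Fin n → X × Z) → ℝ} {c c' : ℝ}
    (h : IsMixtureBounded n G c) (hc : c ≤ c') : IsMixtureBounded n G c' := by
  obtain ⟨ρ, h0, hs, hG⟩ := h
  exact ⟨ρ, h0, hs.trans hc, hG⟩

theorem isMixtureBounded_one_of_length_zero :
    IsMixtureBounded 0 (fun _ : Fin 0 → X × Z => 1) 1 :=
  ⟨fun _ => 1, fun _ => zero_le_one, by simp, fun τ => by simp [agreeIndicator]⟩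

open Classical in
theorem IsMixtureBounded.cons {n : ℕ} {G : (Fin n → X × Z) → ℝ} {c b : ℝ}
    (h : IsMixtureBounded n G c) (q : X → Z → ℝ) (κ : (X → Z) → ℝ) (hκ : ∀ g, 0 ≤ κ g)
    (hb : ∑ g, κ g = b) (hq : ∀ x z, q x z = ∑ g, κ g * if g x = z then 1 else 0) :
    IsMixtureBounded (n + 1) (fun τ => q (τ 0).1 (τ 0).2 * G (Fin.tail τ)) (b * c) := by
  obtain ⟨ρ, h0, hs, hG⟩ := h
  have htail (g : X → Z) (ω : Fin n → X → Z) :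
      Fin.tail (Fin.consEquiv (fun _ => X → Z) (g, ω)) = ω := rfl
  have hb0 : 0 ≤ b := hb ▸ sum_nonneg fun g _ => hκ g
  refine ⟨fun ω => κ (ω 0) * ρ (Fin.tail ω), fun ω => mul_nonneg (hκ _) (h0 _), ?_, fun τ => ?_⟩
  · rw [← (Fin.consEquiv fun _ => X → Z).sum_comp, Fintype.sum_prod_type]
    simp only [htail, Fin.consEquiv_apply, Fin.cons_zero, ← mul_sum, ← sum_mul, hb]
    exact mul_le_mul_of_nonneg_left hs hb0
  · have hq0 : 0 ≤ q (τ 0).1 (τ 0).2 := by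
      rw [hq]
      exact sum_nonneg fun g _ => mul_nonneg (hκ g) (by split_ifs <;> norm_num)
    refine (mul_le_mul_of_nonneg_left (hG _) hq0).trans (le_of_eq ?_)
    rw [← (Fin.consEquiv fun _ => X → Z).sum_comp, Fintype.sum_prod_type, hq, sum_mul]
    refine sum_congr rfl fun g _ => ?_
    rw [mul_sum]
    refine sum_congr rfl fun ω _ => ?_
    have hcons : agreeIndicator (Fin.consEquiv (fun _ => X → Z) (g, ω)) τ = _ :=
      agreeIndicator_cons g ω τ
    simp only [htail, hcons, Fin.consEquiv_apply, Fin.cons_zero]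
    ring

/-- A stochastic kernel is a mixture of deterministic maps. -/
theorem IsMixtureBounded.cons_kernel {n : ℕ} {G : (Fin n → X × Z) → ℝ} {c : ℝ}
    (h : IsMixtureBounded n G c) (q : X → Z → ℝ) (hq : ∀ x z, 0 ≤ q x z)
    (hq1 : ∀ x, ∑ z, q x z = 1) :
    IsMixtureBounded (n + 1) (fun τ => q (τ 0).1 (τ 0).2 * G (Fin.tail τ)) c := by
  classical
  have hprod (f : X → Z → ℝ) : ∑ g : X → Z, ∏ x, f x (g x) = ∏ x, ∑ z, f x z := by
    rw [Finset.prod_univ_sum, Fintype.piFinset_univ]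
  rw [← one_mul c]
  refine h.cons q (fun g => ∏ x, q x (g x)) (fun g => prod_nonneg fun x _ => hq _ _) ?_ ?_
  · simp [hprod, hq1]
  · intro x z
    have (g : X → Z) : (∏ y, q y (g y)) * (if g x = z then 1 else 0)
        = ∏ y, q y (g y) * (if y = x then (if g y = z then 1 else 0) else 1) := by
      rw [prod_mul_distrib, prod_ite_eq' univ x]
      simp
    simp only [this]
    rw [hprod fun y u => q y u * (if y = x then (if u = z then 1 else 0) else 1),
      prod_eq_single x]
    · simp
    · intro y _ hy
      simp [hy, hq1]
    · simp

/-- An unconstrained outcome is dominated by the sum of the constant maps. -/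
theorem IsMixtureBounded.cons_const [Nonempty X] {n : ℕ} {G : (Fin n → X × Z) → ℝ} {c : ℝ}
    (h : IsMixtureBounded n G c) :
    IsMixtureBounded (n + 1) (fun τ => G (Fin.tail τ)) (Fintype.card Z * c) := by
  classical
  have hinj : Function.Injective (Function.const X : Z → X → Z) := Function.const_injective
  have key (f : (X → Z) → ℝ) :
      ∑ g, (if g ∈ univ.image (Function.const X : Z → X → Z) then 1 else 0) * f g
        = ∑ z, f (Function.const X z) := by
    simp only [ite_mul, one_mul, zero_mul]
    rw [sum_ite_mem, univ_inter, sum_image fun _ _ _ _ e => hinj e]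
  have := h.cons (fun _ _ => 1)
    (fun g => if g ∈ univ.image (Function.const X : Z → X → Z) then 1 else 0)
    (fun g => by split_ifs <;> norm_num) (b := Fintype.card Z)
    (by simpa using key fun _ => 1) (fun x z => by
      rw [key, sum_eq_single z] <;> simp +contextual)
  simpa using this

theorem isMixtureBounded_one [Nonempty X] (n : ℕ) :
    IsMixtureBounded n (fun _ : Fin n → X × Z => 1) ((Fintype.card Z : ℝ) ^ n) := by
  induction n with
  | zero => simpa using isMixtureBounded_one_of_length_zero
  | succ n ih => rw [pow_succ']; exact ih.cons_const

end Mixture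

section Elimination

variable {X Z : Type*}

/-- The dominating weight obtained by eliminating the contexts one at a time along the sequence. -/
def eliminationWeight : List (X × Z) → (M : ℕ) → (Fin M → X → Z → ℝ) → ℝ
  | _, 0, _ => 0
  | [], _ + 1, _ => 1
  | p :: l, M + 1, μ =>
    μ (Fin.last M) p.1 p.2 * eliminationWeight l (M + 1) μ
      + 2 * eliminationWeight l M fun m => μ m.castSucc

/-- A signed mixture of `M` product models whose moments of order less than `M` are at most `δ`
is bounded by `δ` times the elimination weight. -/
theorem abs_sum_prod_le_eliminationWeight (l : List (X × Z)) :
    ∀ (M : ℕ) (μ : Fin M → X → Z → ℝ) (v : Fin M → ℝ) (δ : ℝ),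
      (∀ m x z, 0 ≤ μ m x z ∧ μ m x z ≤ 1) →
      (∀ l' : List (X × Z), l'.Sublist l → l'.length < M →
        |∑ m, v m * (l'.map fun p => μ m p.1 p.2).prod| ≤ δ) →
      |∑ m, v m * (l.map fun p => μ m p.1 p.2).prod| ≤ δ * eliminationWeight l M μ := by
  induction l with
  | nil =>
    intro M μ v δ _ h
    cases M with
    | zero => simp [eliminationWeight]
    | succ M => simpa [eliminationWeight] using h [] (List.Sublist.refl _) (by simp)
  | cons p l ih =>
    intro M μ v δ hμ h
    cases M with
    | zero => simp [eliminationWeight]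
    | succ M =>
      set a := μ (Fin.last M) p.1 p.2 with ha
      have ha0 : 0 ≤ a := (hμ _ _ _).1
      have ha1 : a ≤ 1 := (hμ _ _ _).2
      have split (l' : List (X × Z)) :
          ∑ m, v m * ((p :: l').map fun p => μ m p.1 p.2).prod
            = a * ∑ m, v m * (l'.map fun p => μ m p.1 p.2).prod
              + ∑ m : Fin M, v m.castSucc * (μ m.castSucc p.1 p.2 - a)
                  * (l'.map fun p => μ m.castSucc p.1 p.2).prod := by
        simp only [Fin.sum_univ_castSucc, List.map_cons, List.prod_cons, mul_add, mul_sum, ← ha]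
        rw [add_right_comm, ← sum_add_distrib]
        congr 1
        · exact sum_congr rfl fun m _ => by ring
        · ring
      have h₁ := ih (M + 1) μ v δ hμ fun l' hl' hlen => h l' (hl'.cons p) hlen
      have h₂ := ih M (fun m => μ m.castSucc)
        (fun m => v m.castSucc * (μ m.castSucc p.1 p.2 - a)) (2 * δ)
        (fun m => hμ m.castSucc) (fun l' hl' hlen => by
          have e := split l'
          have e₁ := abs_le.1 (h (p :: l') (hl'.cons_cons p) (by simpa using hlen))
          have e₂ := h l' (hl'.cons p) (by omega)
          have e₃ : |a * ∑ m, v m * (l'.map fun p => μ m p.1 p.2).prod| ≤ δ := by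
            rw [abs_mul, abs_of_nonneg ha0]
            exact (mul_le_of_le_one_left (abs_nonneg _) ha1).trans e₂
          have e₃ := abs_le.1 e₃
          exact abs_le.2 ⟨by linarith, by linarith⟩)
      rw [split l]
      refine (abs_add_le _ _).trans ?_
      rw [abs_mul, abs_of_nonneg ha0]
      have h₃ := mul_le_mul_of_nonneg_left h₁ ha0
      simp only [eliminationWeight, ← ha]
      linarith

theorem isMixtureBounded_eliminationWeight [Fintype X] [Fintype Z] [DecidableEq X] [Nonempty X]
    (n : ℕ) :
    ∀ (M : ℕ) (μ : Fin (M + 1) → X → Z → ℝ), IsRewardModel μ →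
      IsMixtureBounded n (fun τ => eliminationWeight (List.ofFn τ) (M + 1) μ)
        ((1 + 2 * Fintype.card Z * n : ℝ) ^ M) := by
  induction n with
  | zero =>
    intro M μ _
    simpa [eliminationWeight] using isMixtureBounded_one_of_length_zero (X := X) (Z := Z)
  | succ n ih =>
    intro M μ hμ
    have h₁ := (ih M μ hμ).cons_kernel (μ (Fin.last M)) (fun x z => (hμ _ x).1 z)
      fun x => (hμ _ x).2
    cases M with
    | zero =>
      simpa [eliminationWeight, List.ofFn_succ, Fin.tail_def] using h₁
    | succ M =>
      have h₂ := (ih M (fun m => μ m.castSucc) fun m => hμ m.castSucc).cons_const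
      have h₃ := (h₁.add (h₂.add h₂)).mono
        (c' := (1 + 2 * Fintype.card Z * (n + 1 : ℕ) : ℝ) ^ (M + 1))
        (by
          have hle : (1 + 2 * Fintype.card Z * n : ℝ) ^ M
              ≤ (1 + 2 * Fintype.card Z * (n + 1 : ℕ) : ℝ) ^ M := by
            gcongr; simp
          have := mul_le_mul_of_nonneg_right hle
            (by positivity : (0 : ℝ) ≤ 1 + 2 * Fintype.card Z * (n + 1 : ℕ))
          refine le_trans (le_of_eq ?_) (this.trans_eq (pow_succ _ _).symm)
          push_cast
          ring)
      simpa only [eliminationWeight, List.ofFn_succ, Fin.tail_def, two_mul] using h₃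

end Elimination

section Moments

variable {X Z : Type*}

/-- Every product along a short enough sublist of a sequence is a product over an index subset
of a subsequence of prescribed length `d`. -/
theorem exists_strictMono_prod_eq_of_sublist {H d : ℕ} (hdH : d ≤ H) (τ : Fin H → X × Z)
    (l : List (X × Z)) (hl : l.Sublist (List.ofFn τ)) (hlen : l.length ≤ d) :
    ∃ (t : Fin d → Fin H) (I : Finset (Fin d)), StrictMono t ∧
      ∀ f : X × Z → ℝ, (l.map f).prod = ∏ i ∈ I, f (τ (t i)) := by
  obtain ⟨e, he⟩ := List.sublist_iff_exists_fin_orderEmbedding_get_eq.1 hl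
  have hτ : (List.ofFn τ).length = H := List.length_ofFn
  let g : Fin l.length ↪ Fin H := e.toEmbedding.trans (finCongr hτ).toEmbedding
  have hg (i) : l.get i = τ (g i) := by
    rw [he i]
    simp [g]
    rfl
  obtain ⟨J, hJ, -, hJc⟩ := exists_subsuperset_card_eq (s := univ.map g) (t := univ) (n := d)
    (subset_univ _) (by simpa using hlen) (by simpa using hdH)
  refine ⟨J.orderEmbOfFin hJc, univ.filter fun i => J.orderEmbOfFin hJc i ∈ univ.map g,
    (J.orderEmbOfFin hJc).strictMono, fun f => ?_⟩
  have h₁ : (l.map f).prod = ∏ j ∈ univ.map g, f (τ j) := by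
    rw [prod_map, ← List.prod_ofFn]
    simp only [← hg]
    congr 1
    apply List.ext_get <;> simp
  rw [h₁]
  symm
  refine prod_nbij (J.orderEmbOfFin hJc) (by simp) (J.orderEmbOfFin hJc).injective.injOn ?_
    (fun _ _ => rfl)
  intro j hj
  have hjJ : j ∈ Set.range (J.orderEmbOfFin hJc) := by
    rw [range_orderEmbOfFin]; exact hJ hj
  obtain ⟨i, rfl⟩ := hjJ
  exact ⟨i, by simpa using hj, rfl⟩

end Moments

section Trajectories

variable {S A Z : Type*}

/-- The contribution of the initial distribution and the transitions to the probability of a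
trajectory with state-action part `x`. -/
noncomputable def transitionWeight (H : ℕ) (T : S × A → S → ℝ) (ν : S → ℝ)
    (x : Fin H → S × A) : ℝ :=
  (if h : 0 < H then ν ((x ⟨0, h⟩).1) else 1)
    * ∏ t : Fin H, if h : (t : ℕ) + 1 < H then T (x t) ((x ⟨(t : ℕ) + 1, h⟩).1) else 1

/-- The contribution of the policy to the probability of a trajectory. -/
noncomputable def policyWeight {H : ℕ} (π : List ((S × A) × Z) → S → A → ℝ)
    (τ : Fin H → (S × A) × Z) : ℝ :=
  ∏ t : Fin H, π ((List.ofFn τ).take t.val) (τ t).1.1 (τ t).1.2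

theorem trajProb_eq {H M : ℕ} (T : S × A → S → ℝ) (ν : S → ℝ)
    (π : List ((S × A) × Z) → S → A → ℝ) (w : Fin M → ℝ) (μ : Fin M → S × A → Z → ℝ)
    (τ : Fin H → (S × A) × Z) :
    trajProb H T ν π w μ τ = transitionWeight H T ν (fun t => (τ t).1) * policyWeight π τ
      * momentOn w μ (fun t => (τ t).1) (fun t => (τ t).2) univ := rfl

theorem transitionWeight_nonneg [Fintype S] {H : ℕ} {T : S × A → S → ℝ} {ν : S → ℝ}
    (hT : ∀ x, IsDist (T x)) (hν : IsDist ν) (x : Fin H → S × A) :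
    0 ≤ transitionWeight H T ν x := by
  refine mul_nonneg ?_ (prod_nonneg fun t _ => ?_)
  · split_ifs
    · exact hν.1 _
    · exact zero_le_one
  · split_ifs
    · exact (hT _).1 _
    · exact zero_le_one

theorem IsPolicy.le_one [Fintype A] {π : List ((S × A) × Z) → S → A → ℝ} (hπ : IsPolicy π)
    (hist : List ((S × A) × Z)) (s : S) (a : A) : π hist s a ≤ 1 :=
  (hπ hist s).2 ▸ single_le_sum (f := π hist s) (fun b _ => (hπ hist s).1 b) (mem_univ a)

theorem policyWeight_nonneg [Fintype A] {H : ℕ} {π : List ((S × A) × Z) → S → A → ℝ}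
    (hπ : IsPolicy π) (τ : Fin H → (S × A) × Z) : 0 ≤ policyWeight π τ :=
  prod_nonneg fun _ _ => (hπ _ _).1 _

theorem policyWeight_le_one [Fintype A] {H : ℕ} {π : List ((S × A) × Z) → S → A → ℝ}
    (hπ : IsPolicy π) (τ : Fin H → (S × A) × Z) : policyWeight π τ ≤ 1 :=
  prod_le_one (fun _ _ => (hπ _ _).1 _) fun _ _ => hπ.le_one _ _ _

theorem momentOn_nonneg {X : Type*} [Fintype Z] {M d : ℕ} {w : Fin M → ℝ}
    {μ : Fin M → X → Z → ℝ} (hw : IsDist w) (hμ : IsRewardModel μ) (x : Fin d → X)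
    (z : Fin d → Z) (I : Finset (Fin d)) : 0 ≤ momentOn w μ x z I :=
  sum_nonneg fun m _ => mul_nonneg (hw.1 m) (prod_nonneg fun _ _ => (hμ m _).1 _)

theorem sum_momentOn_univ {X : Type*} [Fintype Z] {M d : ℕ} {w : Fin M → ℝ}
    {μ : Fin M → X → Z → ℝ} (hw : IsDist w) (hμ : IsRewardModel μ) (x : Fin d → X) :
    ∑ z : Fin d → Z, momentOn w μ x z univ = 1 := by
  classical
  simp only [momentOn]
  rw [sum_comm, ← hw.2]
  refine sum_congr rfl fun m _ => ?_
  rw [← mul_sum, ← Fintype.piFinset_univ,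
    ← Finset.prod_univ_sum (fun _ => univ) fun i z => μ m (x i) z]
  simp [(hμ m _).2]

theorem eventProb_le_supEventProb [Fintype S] [Fintype A] [Fintype Z] [DecidableEq S]
    [DecidableEq A] {H : ℕ} {T : S × A → S → ℝ} {ν : S → ℝ} (hT : ∀ x, IsDist (T x))
    (hν : IsDist ν) {M : ℕ} {w : Fin M → ℝ} {μ : Fin M → S × A → Z → ℝ} (hw : IsDist w)
    (hμ : IsRewardModel μ) (E : Finset (Fin H → S × A))
    {π : List ((S × A) × Z) → S → A → ℝ} (hπ : IsPolicy π) :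
    eventProb H T ν π w μ E ≤ supEventProb H T ν w μ E := by
  refine le_ciSup (f := fun π : {p : List ((S × A) × Z) → S → A → ℝ // IsPolicy p} =>
    eventProb H T ν π.1 w μ E) ⟨∑ τ : Fin H → (S × A) × Z,
      transitionWeight H T ν (fun t => (τ t).1)
        * momentOn w μ (fun t => (τ t).1) (fun t => (τ t).2) univ, ?_⟩ ⟨π, hπ⟩
  rintro _ ⟨⟨p, hp⟩, rfl⟩
  refine sum_le_sum fun τ _ => ?_
  have hK := transitionWeight_nonneg hT hν fun t => (τ t).1
  have hM := momentOn_nonneg hw hμ (fun t => (τ t).1) (fun t => (τ t).2) univ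
  split_ifs
  · rw [trajProb_eq]
    exact mul_le_mul_of_nonneg_right (mul_le_of_le_one_right hK (policyWeight_le_one hp τ)) hM
  · exact mul_nonneg hK hM

theorem eventProb_nonneg [Fintype S] [Fintype A] [Fintype Z] [DecidableEq S]
    [DecidableEq A] {H : ℕ} {T : S × A → S → ℝ} {ν : S → ℝ} (hT : ∀ x, IsDist (T x))
    (hν : IsDist ν) {M : ℕ} {w : Fin M → ℝ} {μ : Fin M → S × A → Z → ℝ} (hw : IsDist w)
    (hμ : IsRewardModel μ) (E : Finset (Fin H → S × A))
    {π : List ((S × A) × Z) → S → A → ℝ} (hπ : IsPolicy π) :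
    0 ≤ eventProb H T ν π w μ E := by
  refine sum_nonneg fun τ _ => ?_
  split_ifs
  · rw [trajProb_eq]
    exact mul_nonneg (mul_nonneg (transitionWeight_nonneg hT hν _) (policyWeight_nonneg hπ τ))
      (momentOn_nonneg hw hμ _ _ _)
  · exact le_rfl

/-- The policy that ignores the observed rewards and plays `π` as if the reward at time `i` in `x`
had been `ω i x`. -/
def simulatedPolicy {H : ℕ} (π : List ((S × A) × Z) → S → A → ℝ) (ω : Fin H → S × A → Z) :
    List ((S × A) × Z) → S → A → ℝ :=
  fun hist => π (hist.mapIdx fun i p => (p.1, if h : i < H then ω ⟨i, h⟩ p.1 else p.2))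

theorem policyWeight_simulatedPolicy {H : ℕ} (π : List ((S × A) × Z) → S → A → ℝ)
    (ω : Fin H → S × A → Z) (τ : Fin H → (S × A) × Z) :
    policyWeight (simulatedPolicy π ω) τ
      = policyWeight π fun t => ((τ t).1, ω t (τ t).1) := by
  refine prod_congr rfl fun t _ => ?_
  simp only [simulatedPolicy]
  congr 1
  apply List.ext_getElem
  · simp
  · intro i h₁ h₂
    have : i < H := by simp at h₁; omega
    simp [this]

theorem eventProb_simulatedPolicy [Fintype S] [Fintype A] [Fintype Z] [DecidableEq S]
    [DecidableEq A] {H : ℕ} (T : S × A → S → ℝ) (ν : S → ℝ) {M : ℕ} {w : Fin M → ℝ}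
    {μ : Fin M → S × A → Z → ℝ} (hw : IsDist w) (hμ : IsRewardModel μ)
    (E : Finset (Fin H → S × A)) (π : List ((S × A) × Z) → S → A → ℝ)
    (ω : Fin H → S × A → Z) :
    eventProb H T ν (simulatedPolicy π ω) w μ E
      = ∑ x : Fin H → S × A, if x ∈ E then
          transitionWeight H T ν x * policyWeight π (fun t => (x t, ω t (x t))) else 0 := by
  rw [eventProb,
    ← (Equiv.arrowProdEquivProdArrow (Fin H) (fun _ => S × A) (fun _ => Z)).symm.sum_comp,
    Fintype.sum_prod_type]
  refine sum_congr rfl fun x _ => ?_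
  simp only [trajProb_eq, policyWeight_simulatedPolicy, Equiv.arrowProdEquivProdArrow,
    Equiv.coe_fn_symm_mk]
  split_ifs
  · rw [← mul_sum, sum_momentOn_univ hw hμ, mul_one]
  · simp

open Classical in
theorem sum_indicator_eq_eventProb [Fintype S] [Fintype A] [Fintype Z] [DecidableEq S]
    [DecidableEq A] {H : ℕ} (T : S × A → S → ℝ) (ν : S → ℝ) {M : ℕ} {w : Fin M → ℝ}
    {μ : Fin M → S × A → Z → ℝ} (hw : IsDist w) (hμ : IsRewardModel μ)
    (E : Finset (Fin H → S × A)) (π : List ((S × A) × Z) → S → A → ℝ)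
    (ω : Fin H → S × A → Z) :
    (∑ τ : Fin H → (S × A) × Z, if (fun t => (τ t).1) ∈ E then
        transitionWeight H T ν (fun t => (τ t).1) * policyWeight π τ
          * agreeIndicator ω τ else 0)
      = eventProb H T ν (simulatedPolicy π ω) w μ E := by
  rw [eventProb_simulatedPolicy T ν hw hμ,
    ← (Equiv.arrowProdEquivProdArrow (Fin H) (fun _ => S × A) (fun _ => Z)).symm.sum_comp,
    Fintype.sum_prod_type]
  refine sum_congr rfl fun x _ => ?_
  simp only [Equiv.arrowProdEquivProdArrow, Equiv.coe_fn_symm_mk, agreeIndicator, ← funext_iff]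
  split_ifs
  · simp
  · simp

/-- Domination of the moment differences by a mixture of mass `c` bounds the distance of the
trajectory distributions restricted to `E`. -/
theorem sum_abs_trajProb_sub_le_of_isMixtureBounded [Fintype S] [Fintype A] [Fintype Z]
    [DecidableEq S] [DecidableEq A] {H : ℕ} {T : S × A → S → ℝ} {ν : S → ℝ}
    (hT : ∀ x, IsDist (T x)) (hν : IsDist ν) {M₁ M₂ : ℕ}
    {w₁ : Fin M₁ → ℝ} {μ₁ : Fin M₁ → S × A → Z → ℝ}
    {w₂ : Fin M₂ → ℝ} {μ₂ : Fin M₂ → S × A → Z → ℝ}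
    (hw₁ : IsDist w₁) (hμ₁ : IsRewardModel μ₁) {δ : ℝ} (hδ : 0 ≤ δ)
    (E : Finset (Fin H → S × A)) {π : List ((S × A) × Z) → S → A → ℝ} (hπ : IsPolicy π)
    {G : (Fin H → (S × A) × Z) → ℝ} {c : ℝ} (hG : IsMixtureBounded H G c)
    (hle : ∀ τ : Fin H → (S × A) × Z, (fun t => (τ t).1) ∈ E →
      |momentOn w₁ μ₁ (fun t => (τ t).1) (fun t => (τ t).2) univ
        - momentOn w₂ μ₂ (fun t => (τ t).1) (fun t => (τ t).2) univ| ≤ δ * G τ) :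
    ∑ τ : Fin H → (S × A) × Z,
        (if (fun t => (τ t).1) ∈ E then
          |trajProb H T ν π w₁ μ₁ τ - trajProb H T ν π w₂ μ₂ τ| else 0)
      ≤ supEventProb H T ν w₁ μ₁ E * c * δ := by
  classical
  obtain ⟨ρ, hρ, hρc, hGρ⟩ := hG
  have hsup : 0 ≤ supEventProb H T ν w₁ μ₁ E :=
    (eventProb_nonneg hT hν hw₁ hμ₁ E hπ).trans
      (eventProb_le_supEventProb hT hν hw₁ hμ₁ E hπ)
  calc
    _ ≤ ∑ τ : Fin H → (S × A) × Z, ∑ ω, δ * (ρ ω * (if (fun t => (τ t).1) ∈ E then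
        transitionWeight H T ν (fun t => (τ t).1) * policyWeight π τ
          * agreeIndicator ω τ else 0)) := by
      refine sum_le_sum fun τ _ => ?_
      split_ifs with h
      · have hK : 0 ≤ transitionWeight H T ν (fun t => (τ t).1) * policyWeight π τ :=
          mul_nonneg (transitionWeight_nonneg hT hν _) (policyWeight_nonneg hπ τ)
        rw [trajProb_eq, trajProb_eq, ← mul_sub, abs_mul, abs_of_nonneg hK]
        refine (mul_le_mul_of_nonneg_left
          ((hle τ h).trans (mul_le_mul_of_nonneg_left (hGρ τ) hδ)) hK).trans (le_of_eq ?_)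
        rw [mul_sum, mul_sum]
        exact sum_congr rfl fun ω _ => by ring
      · simp
    _ = δ * ∑ ω, ρ ω * eventProb H T ν (simulatedPolicy π ω) w₁ μ₁ E := by
      rw [sum_comm, mul_sum]
      refine sum_congr rfl fun ω _ => ?_
      rw [← sum_indicator_eq_eventProb T ν hw₁ hμ₁, ← mul_sum, ← mul_sum]
    _ ≤ δ * ∑ ω, ρ ω * supEventProb H T ν w₁ μ₁ E := by
      gcongr with ω
      · exact hρ ω
      · exact eventProb_le_supEventProb hT hν hw₁ hμ₁ E fun hist s => hπ _ s
    _ ≤ δ * (c * supEventProb H T ν w₁ μ₁ E) := by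
      rw [← sum_mul]
      gcongr
    _ = _ := by ring

end Trajectories

section MomentCloseness

variable {X Z : Type*}

/-- Closeness of the moments of order at most `M₁ + M₂ - 1` bounds the difference of two mixtures
with `M₁` and `M₂` contexts by the elimination weight. -/
theorem abs_momentOn_sub_le_eliminationWeight [Fintype Z] {M₁ M₂ H d : ℕ}
    {w₁ : Fin M₁ → ℝ} {μ₁ : Fin M₁ → X → Z → ℝ} {w₂ : Fin M₂ → ℝ} {μ₂ : Fin M₂ → X → Z → ℝ}
    (hμ : IsRewardModel (Fin.append μ₁ μ₂)) {δ : ℝ} (hdH : d ≤ H) (hd : M₁ + M₂ ≤ d + 1)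
    (τ : Fin H → X × Z)
    (h : ∀ t : Fin d → Fin H, StrictMono t → ∀ I : Finset (Fin d),
      |momentOn w₁ μ₁ (fun i => (τ (t i)).1) (fun i => (τ (t i)).2) I
        - momentOn w₂ μ₂ (fun i => (τ (t i)).1) (fun i => (τ (t i)).2) I| ≤ δ) :
    |momentOn w₁ μ₁ (fun t => (τ t).1) (fun t => (τ t).2) univ
        - momentOn w₂ μ₂ (fun t => (τ t).1) (fun t => (τ t).2) univ|
      ≤ δ * eliminationWeight (List.ofFn τ) (M₁ + M₂) (Fin.append μ₁ μ₂) := by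
  have key (n : ℕ) (σ : Fin n → X × Z) (I : Finset (Fin n)) :
      momentOn w₁ μ₁ (fun t => (σ t).1) (fun t => (σ t).2) I
        - momentOn w₂ μ₂ (fun t => (σ t).1) (fun t => (σ t).2) I
      = ∑ m, Fin.append w₁ (fun m => -w₂ m) m
          * ∏ i ∈ I, Fin.append μ₁ μ₂ m (σ i).1 (σ i).2 := by
    simp [momentOn, Fin.sum_univ_add, sub_eq_add_neg]
  rw [key H τ univ]
  have := abs_sum_prod_le_eliminationWeight (List.ofFn τ) (M₁ + M₂) (Fin.append μ₁ μ₂)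
    (Fin.append w₁ fun m => -w₂ m) δ
    (fun m x z => ⟨(hμ m x).1 z, (hμ m x).2 ▸
      single_le_sum (f := Fin.append μ₁ μ₂ m x) (fun b _ => (hμ m x).1 b) (mem_univ z)⟩)
    (fun l hl hlen => by
      obtain ⟨t, I, ht, hprod⟩ :=
        exists_strictMono_prod_eq_of_sublist hdH τ l hl (by omega)
      simp only [hprod fun p => Fin.append μ₁ μ₂ _ p.1 p.2]
      rw [← key d (fun i => τ (t i)) I]
      exact h t ht I)
  simpa [List.map_ofFn, List.prod_ofFn] using this

theorem IsRewardModel.append [Fintype Z] {M₁ M₂ : ℕ} {μ₁ : Fin M₁ → X → Z → ℝ}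
    {μ₂ : Fin M₂ → X → Z → ℝ} (h₁ : IsRewardModel μ₁) (h₂ : IsRewardModel μ₂) :
    IsRewardModel (Fin.append μ₁ μ₂) := by
  intro m
  refine Fin.addCases (fun i => ?_) (fun i => ?_) m
  · simpa using h₁ i
  · simpa using h₂ i

theorem IsDist.nonempty [Fintype X] {p : X → ℝ} (h : IsDist p) : Nonempty X := by
  by_contra hX
  rw [not_nonempty_iff] at hX
  simpa using h.2

end MomentCloseness

/-- Theorem: Bound on Total Variation from Moment Closeness.
If two RMMDPs `𝓜⁽¹⁾, 𝓜⁽²⁾` over the same `S, A, Z` and horizon `H` share the transition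
kernel `T` and initial distribution `ν`, and `E` is a set of length-`H` state-action
sequences all of whose length-`d` subsequences (`d = min(H, M₁+M₂−1)`) have all their
moments (over all `z` and all index subsets `I`) matching up to `δ`, then for every
history-dependent policy `π` the statistical distance of trajectories restricted to `E`
is at most `sup_{π'} P⁽¹⁾_{π'}(x_{1:H} ∈ E) · (4HZ)^d · δ`. -/
theorem statement0 {S A Z : Type*} [Fintype S] [Fintype A] [Fintype Z]
    [DecidableEq S] [DecidableEq A]
    (H : ℕ) (T : S × A → S → ℝ) (ν : S → ℝ)
    (hT : ∀ x, IsDist (T x)) (hν : IsDist ν)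
    {M₁ M₂ : ℕ}
    (w₁ : Fin M₁ → ℝ) (μ₁ : Fin M₁ → S × A → Z → ℝ)
    (w₂ : Fin M₂ → ℝ) (μ₂ : Fin M₂ → S × A → Z → ℝ)
    (hw₁ : IsDist w₁) (hw₂ : IsDist w₂)
    (hμ₁ : IsRewardModel μ₁) (hμ₂ : IsRewardModel μ₂)
    (δ : ℝ) (hδ : 0 < δ)
    (d : ℕ) (hd : d = min H (M₁ + M₂ - 1))
    (E : Finset (Fin H → S × A))
    (hE : ∀ x ∈ E, ∀ t : Fin d → Fin H, StrictMono t →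
      ∀ (z : Fin d → Z) (I : Finset (Fin d)),
        |momentOn w₁ μ₁ (x ∘ t) z I - momentOn w₂ μ₂ (x ∘ t) z I| ≤ δ)
    (π : List ((S × A) × Z) → S → A → ℝ) (hπ : IsPolicy π) :
    ∑ τ : Fin H → (S × A) × Z,
        (if (fun t => (τ t).1) ∈ E then
          |trajProb H T ν π w₁ μ₁ τ - trajProb H T ν π w₂ μ₂ τ| else 0)
      ≤ supEventProb H T ν w₁ μ₁ E * (4 * H * Fintype.card Z : ℝ) ^ d * δ := by
  obtain ⟨s₀⟩ := hν.nonempty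
  obtain ⟨a₀⟩ := IsDist.nonempty (hπ [] s₀)
  have hX : Nonempty (S × A) := ⟨(s₀, a₀)⟩
  obtain ⟨m₁⟩ := hw₁.nonempty
  obtain ⟨m₂⟩ := hw₂.nonempty
  obtain ⟨z₀⟩ := IsDist.nonempty (hμ₁ m₁ (s₀, a₀))
  have hZ : (1 : ℝ) ≤ Fintype.card Z := by
    exact_mod_cast Fintype.card_pos_iff.2 ⟨z₀⟩
  rcases le_or_gt H (M₁ + M₂ - 1) with hH | hH
  · obtain rfl : d = H := by omega
    refine sum_abs_trajProb_sub_le_of_isMixtureBounded hT hν hw₁ hμ₁ hδ.le E hπ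
      ((isMixtureBounded_one d).mono ?_) fun τ hτ => ?_
    · rcases Nat.eq_zero_or_pos d with rfl | hpos
      · simp
      · have : (1 : ℝ) ≤ d := by exact_mod_cast hpos
        gcongr
        nlinarith
    · simpa using hE _ hτ id strictMono_id (fun t => (τ t).2) univ
  · have h₁ := m₁.pos
    have h₂ := m₂.pos
    obtain ⟨M, hM⟩ : ∃ M, M₁ + M₂ = M + 1 := ⟨M₁ + M₂ - 1, by omega⟩
    obtain rfl : d = M := by omega
    have hμ := hμ₁.append hμ₂
    have hmix : IsMixtureBounded H
        (fun τ => eliminationWeight (List.ofFn τ) (M₁ + M₂) (Fin.append μ₁ μ₂))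
        ((1 + 2 * Fintype.card Z * H : ℝ) ^ d) := by
      have := isMixtureBounded_eliminationWeight (X := S × A) (Z := Z) H d
      rw [← hM] at this
      exact this _ hμ
    refine sum_abs_trajProb_sub_le_of_isMixtureBounded hT hν hw₁ hμ₁ hδ.le E hπ
      (hmix.mono ?_) fun τ hτ => ?_
    · have : (1 : ℝ) ≤ H := by exact_mod_cast (show 1 ≤ H by omega)
      gcongr
      nlinarith
    · exact abs_momentOn_sub_le_eliminationWeight hμ (by omega) hM.le τ
        fun t ht I => hE _ hτ t ht (fun i => (τ (t i)).2) I
end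

section
/- There exists a universal constant c > 0 such that for every M ∈ ℕ₊ there is an integer d with d ≥ c·√M having the following property: for every ε with 0 < ε ≤ (2d)^{−2d} there exist mixing weights w₁,…,w_M ≥ 0 with Σ_m w_m = 1 and vectors μ*₁,…,μ*_M ∈ [0,1]^d such that (i) for every proper subset I ⊊ {1,…,d}, Σ_{m=1}^M w_m Π_{t∈I} μ*_m(t) = (1/2)^{|I|}, and (ii) Σ_{m=1}^M w_m Π_{t=1}^{d} μ*_m(t) ≥ (1/2)^d + ε. -/
open Finset

open Polynomial in
/-- The alternating binomial sum of the values of a polynomial of degree at most `n` at `0, …, n`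
is `n!` times its coefficient of degree `n`. -/
theorem sum_alternating_choose_mul_eval (n : ℕ) (p : ℝ[X]) (hp : p.natDegree ≤ n) :
    ∑ k ∈ range (n + 1), (-1 : ℝ) ^ (n - k) * n.choose k * p.eval (k : ℝ)
      = p.coeff n * n.factorial := by
  have hsum := fwdDiff_iter_eq_sum_shift (1 : ℝ) p.eval n 0
  have hdiff : (fwdDiff (1 : ℝ))^[n] p.eval 0 = p.coeff n * n.factorial := by
    rcases hp.lt_or_eq with h | rfl
    · rw [fwdDiff_iter_eq_zero_of_degree_lt h, coeff_eq_zero_of_natDegree_lt h]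
      simp
    · rw [fwdDiff_iter_degree_eq_factorial]
      simp
  rw [← hdiff, hsum]
  exact sum_congr rfl fun k _ => by simp

/-- Alternating binomial sums annihilate powers of low degree. -/
theorem sum_alternating_choose_mul_pow (n k : ℕ) (hk : k ≤ n) :
    ∑ i ∈ range (n + 1), (-1 : ℝ) ^ (n - i) * n.choose i * (i : ℝ) ^ k
      = if k = n then (n.factorial : ℝ) else 0 := by
  have h := sum_alternating_choose_mul_eval n (Polynomial.X ^ k) (by simpa using hk)
  simp only [Polynomial.eval_pow, Polynomial.eval_X, Polynomial.coeff_X_pow] at h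
  rw [h]
  simp [eq_comm]

theorem sum_choose_real (n : ℕ) : ∑ i ∈ range (n + 1), (n.choose i : ℝ) = 2 ^ n := by
  exact_mod_cast Nat.sum_range_choose n

/-- The signed distance from the even node `2 * j` to the odd node `2 * t + 1`. -/
def nodeGap (j t : ℕ) : ℝ := 2 * j - 2 * t - 1

theorem one_le_nodeGap {j t : ℕ} (h : t < j) : 1 ≤ nodeGap j t := by
  have : (t : ℝ) + 1 ≤ j := by exact_mod_cast h
  unfold nodeGap
  linarith

theorem nodeGap_le_neg_one {j t : ℕ} (h : j ≤ t) : nodeGap j t ≤ -1 := by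
  have : (j : ℝ) ≤ t := by exact_mod_cast h
  unfold nodeGap
  linarith

theorem one_le_abs_nodeGap (j t : ℕ) : 1 ≤ |nodeGap j t| := by
  rcases lt_or_ge t j with h | h
  · exact (one_le_nodeGap h).trans (le_abs_self _)
  · exact le_abs.2 (Or.inr (by linarith [nodeGap_le_neg_one h]))

theorem nodeGap_ne_zero (j t : ℕ) : nodeGap j t ≠ 0 := by
  have := one_le_abs_nodeGap j t
  exact abs_pos.1 (by linarith)

open Polynomial in
/-- Alternating binomial sums of products of at most `d` of the factors `nodeGap j t`. -/
theorem sum_alternating_choose_mul_prod_nodeGap (d : ℕ) (S : Finset (Fin d)) :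
    ∑ j ∈ range (d + 1), (-1 : ℝ) ^ (d - j) * d.choose j * ∏ t ∈ S, nodeGap j t
      = if S = univ then 2 ^ d * (d.factorial : ℝ) else 0 := by
  set p : ℝ[X] := ∏ t ∈ S, (C 2 * X + C (-2 * (t : ℝ) - 1)) with hp
  have hfactor : ∀ t : Fin d, (C 2 * X + C (-2 * (t : ℝ) - 1)).natDegree = 1 := fun t =>
    natDegree_linear two_ne_zero
  have hle : p.natDegree ≤ S.card := by
    refine (natDegree_prod_le _ _).trans ?_
    rw [sum_congr rfl fun t _ => hfactor t, sum_const, smul_eq_mul, mul_one]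
  have hcard : S.card ≤ d := by simpa using card_le_univ S
  have heval : ∀ j : ℕ, p.eval (j : ℝ) = ∏ t ∈ S, nodeGap j t := fun j => by
    rw [hp, eval_prod]
    refine prod_congr rfl fun t _ => ?_
    simp only [eval_add, eval_mul, eval_C, eval_X, nodeGap]
    ring
  simp_rw [← heval]
  rw [sum_alternating_choose_mul_eval d p (hle.trans hcard)]
  split_ifs with hS
  · subst hS
    have h := coeff_prod_of_natDegree_le (s := univ)
      (fun t : Fin d => (C 2 * X + C (-2 * (t : ℝ) - 1) : ℝ[X])) 1 fun t _ => (hfactor t).le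
    simp only [card_univ, Fintype.card_fin, mul_one] at h
    rw [hp, h]
    simp only [coeff_add, coeff_C_mul, coeff_X_one, coeff_C_of_ne_zero one_ne_zero, mul_one, add_zero,
      prod_const, card_univ, Fintype.card_fin]
  · have hlt : S.card < d := by
      simpa using card_lt_card (ssubset_univ_iff.2 hS)
    rw [coeff_eq_zero_of_natDegree_lt (hle.trans_lt hlt), zero_mul]

/-- The even and odd nodes interlace, so the sign of `∏ t, nodeGap j t` is `(-1) ^ (d - j)`. -/
theorem neg_one_pow_mul_prod_nodeGap_nonneg {d j : ℕ} (hj : j ≤ d) :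
    0 ≤ (-1 : ℝ) ^ (d - j) * ∏ t : Fin d, nodeGap j t := by
  rw [Fin.prod_univ_eq_prod_range (fun t => nodeGap j t) d, ← prod_range_mul_prod_Ico _ hj,
    mul_left_comm, ← Nat.card_Ico j d, ← prod_const, ← prod_mul_distrib]
  refine mul_nonneg (prod_nonneg fun t ht => ?_) (prod_nonneg fun t ht => ?_)
  · linarith [one_le_nodeGap (mem_range.1 ht)]
  · linarith [nodeGap_le_neg_one (mem_Ico.1 ht).1]

/-- The weight of the grid point `(j, i)`. -/
noncomputable def gridWeight (d j i : ℕ) : ℝ :=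
  (∏ t : Fin d, nodeGap j t) / (4 ^ d * d.factorial) *
    ((-1) ^ (d - j) * d.choose j * d.choose i + d.choose j * ((-1) ^ (d - i) * d.choose i))

/-- The deviation from `1 / 2` of coordinate `t` at the grid point `(j, i)`. -/
noncomputable def gridDeviation (d j i t : ℕ) : ℝ := i / (2 * d) * (nodeGap j t)⁻¹

theorem gridWeight_nonneg {d j : ℕ} (i : ℕ) (hj : j ≤ d) : 0 ≤ gridWeight d j i := by
  have hsign := neg_one_pow_mul_prod_nodeGap_nonneg hj
  have hsq : ((-1 : ℝ) ^ (d - j)) * (-1) ^ (d - j) = 1 := by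
    rw [← mul_pow]
    simp
  have hone : 0 ≤ 1 + (-1 : ℝ) ^ (d - j) * (-1) ^ (d - i) := by
    rw [← pow_add]
    rcases neg_one_pow_eq_or ℝ (d - j + (d - i)) with h | h <;> rw [h] <;> norm_num
  have hfactor : gridWeight d j i = ((-1 : ℝ) ^ (d - j) * ∏ t : Fin d, nodeGap j t) /
      (4 ^ d * d.factorial) * (d.choose j * d.choose i) *
        (1 + (-1 : ℝ) ^ (d - j) * (-1) ^ (d - i)) := by
    unfold gridWeight
    linear_combination (-((∏ t : Fin d, nodeGap j t) / (4 ^ d * d.factorial) *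
      (d.choose j * d.choose i) * (-1) ^ (d - i))) * hsq
  rw [hfactor]
  positivity

theorem abs_gridDeviation_le {d i : ℕ} (j t : ℕ) (hi : i ≤ d) :
    |gridDeviation d j i t| ≤ 1 / 2 := by
  have hratio : (i : ℝ) / (2 * d) ≤ 1 / 2 := by
    rcases d.eq_zero_or_pos with rfl | hd
    · simp
    · have : (i : ℝ) ≤ d := by exact_mod_cast hi
      rw [div_le_div_iff₀ (by positivity) (by positivity)]
      linarith
  have hinv : |(nodeGap j t)⁻¹| ≤ 1 := by
    rw [abs_inv]
    exact inv_le_one_of_one_le₀ (one_le_abs_nodeGap j t)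
  have hnonneg : 0 ≤ (i : ℝ) / (2 * d) := by positivity
  rw [gridDeviation, abs_mul, abs_of_nonneg hnonneg]
  calc _ ≤ (1 / 2 : ℝ) * 1 := by gcongr
    _ = 1 / 2 := mul_one _

/-- The multilinear moments of the grid deviations vanish in all degrees other than `0` and `d`. -/
theorem sum_gridWeight_mul_prod_gridDeviation {d : ℕ} (hd : 0 < d) (J : Finset (Fin d)) :
    ∑ j ∈ range (d + 1), ∑ i ∈ range (d + 1),
        gridWeight d j i * ∏ t ∈ J, gridDeviation d j i t
      = (if J = ∅ then 1 else 0) + if J = univ then 1 / (4 * d : ℝ) ^ d else 0 := by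
  have hcard : J.card ≤ d := by simpa using card_le_univ J
  have hterm : ∀ j i : ℕ, gridWeight d j i * ∏ t ∈ J, gridDeviation d j i t =
      (1 / (4 ^ d * d.factorial * (2 * d : ℝ) ^ J.card)) *
      (((-1 : ℝ) ^ (d - j) * d.choose j * ∏ t ∈ Jᶜ, nodeGap j t) *
          (d.choose i * (i : ℝ) ^ J.card) +
        (d.choose j * ∏ t ∈ Jᶜ, nodeGap j t) *
          ((-1 : ℝ) ^ (d - i) * d.choose i * (i : ℝ) ^ J.card)) := fun j i => by
    have hprod : ∏ t ∈ J, nodeGap j t ≠ 0 := prod_ne_zero_iff.2 fun t _ => nodeGap_ne_zero j t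
    simp only [gridWeight, gridDeviation, prod_mul_distrib, prod_const, prod_inv_distrib]
    rw [← prod_mul_prod_compl J, div_pow]
    field_simp
  simp_rw [hterm, ← mul_sum, sum_add_distrib, ← mul_sum, ← sum_mul]
  rw [sum_alternating_choose_mul_prod_nodeGap, sum_alternating_choose_mul_pow d _ hcard]
  have hd' : (d : ℝ) ≠ 0 := by positivity
  have hfact : (d.factorial : ℝ) ≠ 0 := by positivity
  have hfour : (4 : ℝ) ^ d = 2 ^ d * 2 ^ d := by rw [← mul_pow]; norm_num
  have : Nonempty (Fin d) := ⟨⟨0, hd⟩⟩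
  by_cases hJ : J = univ
  · subst hJ
    simp only [compl_univ, card_univ, Fintype.card_fin, prod_empty, mul_one,
      sum_choose_real, if_true, univ_nonempty.ne_empty, univ_nonempty.ne_empty.symm, if_false,
      mul_pow, hfour]
    field_simp
    ring
  · have hlt : J.card ≠ d := by
      simpa using (card_lt_card (ssubset_univ_iff.2 hJ)).ne
    by_cases hJ' : J = ∅
    · subst hJ'
      simp only [compl_empty, card_empty, pow_zero, mul_one, sum_choose_real, if_true, hd.ne,
        if_false, hJ, hfour, mul_zero, add_zero]
      field_simp
    · simp [hJ, hJ', hlt]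

/-- A finitely supported mixture of product distributions whose centred multilinear moments vanish
in all degrees strictly between `0` and `d` may be indexed by any larger set of components. -/
theorem exists_mixture_of_centred_moments {ι : Type*} [Fintype ι] {d M : ℕ}
    (hM : Fintype.card ι ≤ M) (w : ι → ℝ) (v : ι → Fin d → ℝ) (δ : ℝ) (hw : ∀ a, 0 ≤ w a)
    (hv : ∀ a t, |v a t| ≤ 1 / 2)
    (hmoment : ∀ J : Finset (Fin d),
      ∑ a, w a * ∏ t ∈ J, v a t = (if J = ∅ then 1 else 0) + if J = univ then δ else 0) :
    ∃ (w' : Fin M → ℝ) (μ : Fin M → Fin d → ℝ),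
      (∀ m, 0 ≤ w' m) ∧ (∀ m t, μ m t ∈ Set.Icc (0 : ℝ) 1) ∧
      ∀ I : Finset (Fin d), ∑ m, w' m * ∏ t ∈ I, μ m t
        = (1 / 2 : ℝ) ^ I.card + if I = univ then δ else 0 := by
  classical
  obtain ⟨e⟩ : Nonempty (ι ↪ Fin M) := Function.Embedding.nonempty_of_card_le (by simpa using hM)
  refine ⟨Function.extend e w 0, Function.extend e (fun a t => v a t + 1 / 2) 0, ?_, ?_, ?_⟩
  · intro m
    by_cases hm : ∃ a, e a = m
    · obtain ⟨a, rfl⟩ := hm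
      rw [e.injective.extend_apply]
      exact hw a
    · rw [Function.extend_apply' _ _ _ hm]
      rfl
  · intro m t
    by_cases hm : ∃ a, e a = m
    · obtain ⟨a, rfl⟩ := hm
      rw [e.injective.extend_apply]
      have := abs_le.1 (hv a t)
      constructor <;> linarith
    · rw [Function.extend_apply' _ _ _ hm]
      simp
  · intro I
    have hsum : ∑ a, w a * ∏ t ∈ I, (v a t + 1 / 2) = ∑ m, Function.extend e w 0 m *
        ∏ t ∈ I, Function.extend e (fun a t => v a t + 1 / 2) 0 m t := by
      refine Fintype.sum_of_injective e e.injective _ _ (fun m hm => ?_) fun a => ?_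
      · rw [Function.extend_apply' _ _ _ hm]
        simp
      · rw [e.injective.extend_apply, e.injective.extend_apply]
    rw [← hsum]
    simp_rw [prod_add, mul_sum, ← mul_assoc]
    rw [sum_comm]
    simp_rw [← sum_mul, hmoment, add_mul, sum_add_distrib, ite_mul, one_mul, zero_mul]
    simp only [sum_ite_eq', mem_powerset, empty_subset, if_true, sdiff_empty, prod_const,
      univ_subset_iff]
    split_ifs with hI <;> simp [hI]

/-- With `(d + 1) ^ 2` components, all moments of degree below `d` can match those of the uniform
distribution while the degree-`d` moment exceeds it by `(4 * d) ^ (-d)`. -/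
theorem exists_mixture_of_sq_le {d M : ℕ} (hd : 0 < d) (hM : (d + 1) * (d + 1) ≤ M) :
    ∃ (w : Fin M → ℝ) (μ : Fin M → Fin d → ℝ),
      (∀ m, 0 ≤ w m) ∧ (∀ m t, μ m t ∈ Set.Icc (0 : ℝ) 1) ∧
      ∀ I : Finset (Fin d), ∑ m, w m * ∏ t ∈ I, μ m t
        = (1 / 2 : ℝ) ^ I.card + if I = univ then 1 / (4 * d : ℝ) ^ d else 0 := by
  refine exists_mixture_of_centred_moments (ι := Fin (d + 1) × Fin (d + 1)) (by simpa using hM)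
    (fun a => gridWeight d a.1 a.2) (fun a t => gridDeviation d a.1 a.2 t) _
    (fun a => gridWeight_nonneg _ (Nat.lt_succ_iff.1 a.1.2))
    (fun a t => abs_gridDeviation_le _ _ (Nat.lt_succ_iff.1 a.2.2)) fun J => ?_
  rw [← sum_gridWeight_mul_prod_gridDeviation hd J, Fintype.sum_prod_type,
    ← Fin.sum_univ_eq_sum_range (fun j => ∑ i ∈ range (d + 1),
      gridWeight d j i * ∏ t ∈ J, gridDeviation d j i t)]
  exact sum_congr rfl fun j _ => Fin.sum_univ_eq_sum_range
    (fun i => gridWeight d j i * ∏ t ∈ J, gridDeviation d j i t) (d + 1)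




/-- lower-bound moment-matching construction.
There is a universal constant `c > 0` such that for every `M ≥ 1` there is `d ≥ c·√M` with:
for every `0 < ε ≤ (2d)^{−2d}` there are mixing weights `w` and vectors
`μ*₁,…,μ*_M ∈ [0,1]^d` whose multilinear moments of every proper subset `I ⊊ {1,…,d}`
equal `(1/2)^{|I|}`, while the full degree-`d` moment is at least `(1/2)^d + ε`. -/
theorem statement5 :
    ∃ c : ℝ, 0 < c ∧
      ∀ M : ℕ, 0 < M →
        ∃ d : ℕ, c * Real.sqrt M ≤ d ∧
          ∀ ε : ℝ, 0 < ε → ε ≤ 1 / (2 * d : ℝ) ^ (2 * d) →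
            ∃ (w : Fin M → ℝ) (μstar : Fin M → Fin d → ℝ),
              (∀ m, 0 ≤ w m) ∧ (∑ m, w m = 1) ∧
              (∀ m t, μstar m t ∈ Set.Icc (0 : ℝ) 1) ∧
              (∀ I : Finset (Fin d), I ≠ Finset.univ →
                ∑ m, w m * ∏ t ∈ I, μstar m t = (1 / 2 : ℝ) ^ I.card) ∧
              (1 / 2 : ℝ) ^ d + ε ≤ ∑ m, w m * ∏ t, μstar m t := by
  refine ⟨1 / 4, by norm_num, fun M hM => ?_⟩
  have hsqrt : √(M : ℝ) ≤ Nat.sqrt M + 1 := Real.real_sqrt_le_nat_sqrt_succ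
  rcases Nat.lt_or_ge M 4 with hsmall | hlarge
  · refine ⟨1, ?_, fun ε hε hle => ⟨fun _ => 1 / M, fun _ _ => 1 / 2 + ε, ?_, ?_, ?_, ?_, ?_⟩⟩
    · have hlt : (Nat.sqrt M : ℝ) + 1 ≤ 2 := by
        have : Nat.sqrt M < 2 := Nat.sqrt_lt.2 (by omega)
        exact_mod_cast this
      push_cast
      linarith
    · intro m
      positivity
    · simp [hM.ne']
    · intro m t
      norm_num at hle
      constructor <;> linarith
    · intro I hI
      obtain rfl : I = ∅ := by
        by_contra hne
        exact hI ((nonempty_iff_ne_empty.2 hne).eq_univ)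
      simp [hM.ne']
    · simp [hM.ne']
  · have hs : 2 ≤ Nat.sqrt M := Nat.le_sqrt.2 hlarge
    obtain ⟨d, hds⟩ : ∃ d, Nat.sqrt M = d + 1 := ⟨Nat.sqrt M - 1, by omega⟩
    have hd : 0 < d := by omega
    have hd' : (1 : ℝ) ≤ d := by exact_mod_cast hd
    obtain ⟨w, μ, hw, hμ, hmoment⟩ := exists_mixture_of_sq_le (M := M) hd
      (by rw [← hds]; exact Nat.sqrt_le M)
    have : Nonempty (Fin d) := ⟨⟨0, hd⟩⟩
    refine ⟨d, ?_, fun ε hε hle => ⟨w, μ, hw, ?_, hμ, fun I hI => ?_, ?_⟩⟩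
    · rw [hds] at hsqrt
      push_cast at hsqrt
      linarith
    · simpa [univ_nonempty.ne_empty.symm] using hmoment ∅
    · simpa [hI] using hmoment I
    · have hbound : 1 / (2 * d : ℝ) ^ (2 * d) ≤ 1 / (4 * d : ℝ) ^ d := by
        rw [pow_mul]
        gcongr
        nlinarith
      rw [hmoment univ]
      simp only [card_univ, Fintype.card_fin, if_true]
      linarith
end

section
/- Let w₁,…,w_M ≥ 0 with Σ_m w_m = 1 and μ*₁,…,μ*_M ∈ [0,1]^d satisfy: (i) for every proper subset I ⊊ {1,…,d}, Σ_m w_m Π_{t∈I} μ*_m(t) = (1/2)^{|I|}, and (ii) Σ_m w_m Π_{t=1}^d μ*_m(t) = (1/2)^d + ε. For p ∈ [0,1] and r ∈ {0,1} write b(p,r) := p if r = 1 and 1 − p if r = 0. Then for every r ∈ {0,1}^{d−1}: (a) Σ_m w_m Π_{t=1}^{d−1} b(μ*_m(t), r_t) = (1/2)^{d−1}, and (b) Σ_m w_m μ*_m(d) · Π_{t=1}^{d−1} b(μ*_m(t), r_t) = (1/2)^d + (−1)^{k} ε, where k := #{ t < d : r_t = 0 }. Consequently, the conditional probability that the d-th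 coordinate equals 1 given the first d−1 coordinates equal r is 1/2 + (−1)^k · ε · 2^{d−1}. -/
open Finset

/-- `b(p, r) = p` if `r = 1` and `1 − p` if `r = 0`. -/
def bfun (p : ℝ) (r : Bool) : ℝ := if r then p else 1 - p

/-- If all proper multilinear moments are `(1/2)^|I|` and the full one is off by `ε`, then so are
the mixed moments in `μ` and `1 - μ`, with a sign given by the number of factors `1 - μ`. -/
theorem sum_mul_prod_mul_prod_one_sub {α ι : Type*} [Fintype α] [Fintype ι] [DecidableEq ι]
    (w : α → ℝ) (μ : α → ι → ℝ) (ε : ℝ)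
    (hmatch : ∀ I : Finset ι, I ≠ univ → ∑ m, w m * ∏ t ∈ I, μ m t = (1 / 2 : ℝ) ^ #I)
    (hfull : ∑ m, w m * ∏ t, μ m t = (1 / 2 : ℝ) ^ Fintype.card ι + ε)
    (Z O : Finset ι) (hd : Disjoint O Z) :
    ∑ m, w m * ((∏ t ∈ O, μ m t) * ∏ t ∈ Z, (1 - μ m t)) =
      (1 / 2 : ℝ) ^ (#O + #Z) + if O ∪ Z = univ then (-1 : ℝ) ^ #Z * ε else 0 := by
  induction Z using Finset.induction_on generalizing O with
  | empty =>
    by_cases hO : O = univ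
    · subst hO
      simpa using hfull
    · simpa [hO] using hmatch O hO
  | insert a Z ha ih =>
    obtain ⟨haO, hOZ⟩ := disjoint_insert_right.mp hd
    have hne : O ∪ Z ≠ univ := fun h => by
      have := h ▸ mem_univ a
      simp [haO, ha] at this
    have h₁ := ih O hOZ
    have h₂ := ih (insert a O) (disjoint_insert_left.mpr ⟨ha, hOZ⟩)
    rw [if_neg hne] at h₁
    rw [card_insert_of_notMem haO, insert_union] at h₂
    rw [card_insert_of_notMem ha, union_insert]
    calc
      _ = ∑ m, w m * ((∏ t ∈ O, μ m t) * ∏ t ∈ Z, (1 - μ m t)) -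
          ∑ m, w m * ((∏ t ∈ insert a O, μ m t) * ∏ t ∈ Z, (1 - μ m t)) := by
        rw [← sum_sub_distrib]
        refine sum_congr rfl fun m _ => ?_
        rw [prod_insert ha, prod_insert haO]
        ring
      _ = _ := by
        rw [h₁, h₂]
        split_ifs <;> ring

/-- A product of Bernoulli probabilities splits into the coordinates equal to `1` and to `0`. -/
theorem prod_bfun {ι : Type*} [Fintype ι] (p : ι → ℝ) (r : ι → Bool) :
    ∏ t, bfun (p t) (r t) =
      (∏ t with r t = true, p t) * ∏ t with r t = false, (1 - p t) := by
  simp [bfun, prod_ite]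

/-- conditional reward probabilities in the lower-bound instance,
with `d = n + 1`.  If all proper-subset multilinear moments equal `(1/2)^{|I|}` while the
full moment is `(1/2)^d + ε`, then for every `r ∈ {0,1}^{d−1}`:
(a) the marginal probability of the first `d−1` coordinates equalling `r` is `(1/2)^{d−1}`,
(b) the probability that additionally the `d`-th coordinate is `1` equals
`(1/2)^d + (−1)^k ε` where `k` is the number of zeros in `r`, and consequently
(c) the conditional probability that the `d`-th coordinate is `1` given the first `d−1`
coordinates equal `r` is `1/2 + (−1)^k · ε · 2^{d−1}`. -/
theorem statement6 (n : ℕ) {M : ℕ} (w : Fin M → ℝ) (hw : IsDist w)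
    (μstar : Fin M → Fin (n + 1) → ℝ)
    (hμ : ∀ m t, μstar m t ∈ Set.Icc (0 : ℝ) 1)
    (ε : ℝ)
    (hmatch : ∀ I : Finset (Fin (n + 1)), I ≠ Finset.univ →
      ∑ m, w m * ∏ t ∈ I, μstar m t = (1 / 2 : ℝ) ^ I.card)
    (hfull : ∑ m, w m * ∏ t, μstar m t = (1 / 2 : ℝ) ^ (n + 1) + ε)
    (r : Fin n → Bool) :
    (∑ m, w m * ∏ t, bfun (μstar m t.castSucc) (r t) = (1 / 2 : ℝ) ^ n) ∧
    (∑ m, w m * (μstar m (Fin.last n) * ∏ t, bfun (μstar m t.castSucc) (r t))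
        = (1 / 2 : ℝ) ^ (n + 1)
          + (-1 : ℝ) ^ ((Finset.univ.filter fun t => r t = false).card) * ε) ∧
    ((∑ m, w m * (μstar m (Fin.last n) * ∏ t, bfun (μstar m t.castSucc) (r t)))
        / (∑ m, w m * ∏ t, bfun (μstar m t.castSucc) (r t))
        = 1 / 2
          + (-1 : ℝ) ^ ((Finset.univ.filter fun t => r t = false).card) * ε * 2 ^ n) := by
  set O : Finset (Fin n) := univ.filter fun t => r t = true with hO
  set Z : Finset (Fin n) := univ.filter fun t => r t = false with hZ
  have hOZ : Disjoint O Z := by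
    rw [disjoint_left]
    simp [hO, hZ]
  have hunion : O ∪ Z = univ := by
    ext t
    simp [hO, hZ]
  have hcard : #O + #Z = n := by
    rw [← card_union_of_disjoint hOZ, hunion, card_univ, Fintype.card_fin]
  have hmoment := sum_mul_prod_mul_prod_one_sub w μstar ε hmatch (by simpa using hfull)
    (Z.map Fin.castSuccEmb)
  have hlast (s : Finset (Fin n)) : Fin.last n ∉ s.map Fin.castSuccEmb := by
    simp [Fin.castSucc_ne_last]
  have hdisj : Disjoint (O.map Fin.castSuccEmb) (Z.map Fin.castSuccEmb) :=
    (disjoint_map _).mpr hOZ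
  have ha : ∑ m, w m * ∏ t, bfun (μstar m t.castSucc) (r t) = (1 / 2 : ℝ) ^ n := by
    have h := hmoment (O.map Fin.castSuccEmb) hdisj
    have hne : O.map Fin.castSuccEmb ∪ Z.map Fin.castSuccEmb ≠ univ := fun h => by
      rw [← map_union] at h
      exact hlast _ (h ▸ mem_univ _)
    rw [if_neg hne] at h
    simpa [prod_bfun, ← hO, ← hZ, hcard] using h
  have hb : ∑ m, w m * (μstar m (Fin.last n) * ∏ t, bfun (μstar m t.castSucc) (r t))
      = (1 / 2 : ℝ) ^ (n + 1) + (-1 : ℝ) ^ #Z * ε := by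
    have h := hmoment (insert (Fin.last n) (O.map Fin.castSuccEmb))
      (disjoint_insert_left.mpr ⟨hlast _, hdisj⟩)
    have huniv : insert (Fin.last n) (O.map Fin.castSuccEmb) ∪ Z.map Fin.castSuccEmb = univ := by
      rw [insert_union, ← map_union, hunion]
      ext t
      cases t using Fin.lastCases <;> simp
    rw [if_pos huniv, card_insert_of_notMem (hlast _), card_map, card_map,
      add_right_comm, hcard] at h
    simp only [prod_insert (hlast O), prod_map, Fin.coe_castSuccEmb] at h
    simpa only [prod_bfun, ← hO, ← hZ, mul_assoc] using h
  refine ⟨ha, hb, ?_⟩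
  rw [ha, hb, one_div_pow, one_div_pow]
  field_simp
  ring
end

section
/- Consider the hard RMMDP instance with horizon H = d > 4: the state space is {1,…,d} with the deterministic transition t → t+1 and initial state 1, the reward support is 𝒵 = {0,1}, the action space 𝒜 is finite with |𝒜| ≥ 2 and designated correct actions a*₁,…,a*_d, and the reward models are μ_m((t,a),1) := μ*_m(t) if a = a*_t and μ_m((t,a),1) := 1/2 otherwise. Suppose w₁,…,w_M ≥ 0 with Σ_m w_m = 1 and μ*₁,…,μ*_M ∈ [0,1]^d satisfy: for every proper I ⊊ {1,…,d}, Σ_m w_m Π_{t∈I} μ*_m(t) = (1/2)^{|I|}, and Σ_m w_m Π_{t=1}^d μ*_m(t) = (1/2)^d + ε, with 0 < ε ≤ (2d)^{−2d}. Then: (a) the optimal value V* := sup over history-dependent policies π of E_π[Σ_{t=1}^d r_t] satisfies V* ≥ d/2 + ε·2^{d−2}; and (b) every history-dependent policy π_ε with E_{π_ε}[Σ_t r_t] ≥ V* − ε satisfies P_{π_ε}(a_{1:d} = a*_{1:d}) ≥ 1/4. -/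
open Finset

/-- Expected cumulative (binary) reward in an RMMDP with reward support `Bool`. -/
noncomputable def cumReward {S A : Type*} [Fintype S] [Fintype A] (H : ℕ)
    (T : S × A → S → ℝ) (ν : S → ℝ)
    (π : List ((S × A) × Bool) → S → A → ℝ)
    {M : ℕ} (w : Fin M → ℝ) (μ : Fin M → S × A → Bool → ℝ) : ℝ :=
  ∑ τ : Fin H → (S × A) × Bool,
    trajProb H T ν π w μ τ * ∑ t, (if (τ t).2 then (1 : ℝ) else 0)

/-- The sign `±1` attached to a binary reward. -/
def rewardSign (b : Bool) : ℝ := if b then 1 else -1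

theorem sum_prod_kernel_eq_one {X : Type*} [Fintype X] (n : ℕ) (k : List X → X → ℝ)
    (hk : ∀ h, ∑ x, k h x = 1) :
    ∑ τ : Fin n → X, ∏ t : Fin n, k ((List.ofFn τ).take t) (τ t) = 1 := by
  induction n generalizing k with
  | zero => simp
  | succ n ih =>
    rw [← (Fin.consEquiv fun _ => X).sum_comp, Fintype.sum_prod_type]
    simp only [Fin.consEquiv_apply, Fin.prod_univ_succ, Fin.cons_zero, Fin.cons_succ,
      List.ofFn_succ, Fin.val_zero, List.take_zero, Fin.val_succ, List.take_succ_cons]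
    simp_rw [← mul_sum]
    calc ∑ x, k [] x * _ = ∑ x, k [] x * 1 :=
          sum_congr rfl fun x _ => by rw [ih (fun h => k (x :: h)) fun h => hk _]
      _ = 1 := by simp [hk]

/-- If every one-step conditional expectation of `f` is `c`, then the expectation of the
sum of `f` along `n` steps is `n * c`. -/
theorem sum_prod_kernel_mul_sum {X : Type*} [Fintype X] (n : ℕ) (k : List X → X → ℝ)
    (f : X → ℝ) (c : ℝ) (hk : ∀ h, ∑ x, k h x = 1) (hf : ∀ h, ∑ x, k h x * f x = c) :
    ∑ τ : Fin n → X, (∏ t : Fin n, k ((List.ofFn τ).take t) (τ t)) * ∑ t, f (τ t) = n * c := by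
  induction n generalizing k with
  | zero => simp
  | succ n ih =>
    rw [← (Fin.consEquiv fun _ => X).sum_comp, Fintype.sum_prod_type]
    simp only [Fin.consEquiv_apply, Fin.prod_univ_succ, Fin.cons_zero, Fin.cons_succ,
      List.ofFn_succ, Fin.val_zero, List.take_zero, Fin.val_succ, List.take_succ_cons,
      Fin.sum_univ_succ]
    calc _ = ∑ x, (k [] x * f x * 1 + k [] x * (n * c)) := by
          refine sum_congr rfl fun x _ => ?_
          rw [← ih (fun h => k (x :: h)) (fun h => hk _) fun h => hf _,
            ← sum_prod_kernel_eq_one n (fun h => k (x :: h)) fun h => hk _,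
            mul_sum, mul_sum, ← sum_add_distrib]
          exact sum_congr rfl fun τ _ => by ring
      _ = (n + 1 : ℕ) * c := by
          rw [sum_add_distrib, ← sum_mul, ← sum_mul, hf, hk]
          push_cast
          ring

section Moments

variable {M d : ℕ} {w : Fin M → ℝ} {p : Fin M → Fin d → ℝ} {ε : ℝ}

/-- The centred mixed moments of a mixture matching the fair coin on all proper subsets. -/
theorem sum_mul_prod_sub_half
    (hmatch : ∀ I : Finset (Fin d), I ≠ univ →
      ∑ m, w m * ∏ t ∈ I, p m t = (1 / 2 : ℝ) ^ I.card)
    (hfull : ∑ m, w m * ∏ t, p m t = (1 / 2 : ℝ) ^ d + ε) (I : Finset (Fin d)) :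
    ∑ m, w m * ∏ t ∈ I, (p m t - 1 / 2) =
      (if I = ∅ then 1 else 0) + (if I = univ then ε else 0) := by
  have hmom : ∀ J : Finset (Fin d),
      ∑ m, w m * ∏ t ∈ J, p m t = (1 / 2 : ℝ) ^ J.card + (if J = univ then ε else 0) := by
    intro J
    by_cases hJ : J = univ
    · simp [hJ, hfull]
    · simp [hJ, hmatch J hJ]
  have hzero : ∑ J ∈ I.powerset, (1 / 2 : ℝ) ^ J.card * ∏ t ∈ I \ J, (-(1 / 2) : ℝ) =
      if I = ∅ then 1 else 0 := by
    have := prod_add (fun _ : Fin d => (1 / 2 : ℝ)) (fun _ => -(1 / 2)) I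
    simp only [prod_const] at this ⊢
    rw [← this]
    simp [zero_pow_eq]
  calc ∑ m, w m * ∏ t ∈ I, (p m t - 1 / 2)
      = ∑ J ∈ I.powerset, (∑ m, w m * ∏ t ∈ J, p m t) * ∏ t ∈ I \ J, (-(1 / 2) : ℝ) := by
        simp_rw [sub_eq_add_neg, prod_add, mul_sum, sum_mul]
        rw [sum_comm]
        exact sum_congr rfl fun _ _ => sum_congr rfl fun _ _ => by ring
    _ = _ := by
        simp_rw [hmom, add_mul, sum_add_distrib]
        rw [hzero]
        congr 1
        by_cases hI : I = univ
        · subst hI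
          rw [sum_eq_single univ] <;> simp +contextual
        · rw [if_neg hI]
          refine sum_eq_zero fun J hJ => ?_
          have : J ≠ univ := fun h => hI (univ_subset_iff.mp (h ▸ mem_powerset.mp hJ))
          simp [this]

theorem sum_mul_prod_half_add (hd : 0 < d)
    (hmatch : ∀ I : Finset (Fin d), I ≠ univ →
      ∑ m, w m * ∏ t ∈ I, p m t = (1 / 2 : ℝ) ^ I.card)
    (hfull : ∑ m, w m * ∏ t, p m t = (1 / 2 : ℝ) ^ d + ε) (c : Fin d → ℝ) :
    ∑ m, w m * ∏ t, (c t * (p m t - 1 / 2) + 1 / 2) = (1 / 2 : ℝ) ^ d + ε * ∏ t, c t := by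
  have hne : (∅ : Finset (Fin d)) ≠ univ := by
    have : Nonempty (Fin d) := ⟨⟨0, hd⟩⟩
    exact univ_nonempty.ne_empty.symm
  calc _ = ∑ I ∈ univ.powerset, (∑ m, w m * ∏ t ∈ I, (p m t - 1 / 2)) *
        ((∏ t ∈ I, c t) * ∏ t ∈ univ \ I, (1 / 2 : ℝ)) := by
        simp_rw [prod_add, mul_sum, sum_mul, prod_mul_distrib]
        rw [sum_comm]
        exact sum_congr rfl fun _ _ => sum_congr rfl fun _ _ => by ring
    _ = _ := by
        simp_rw [sum_mul_prod_sub_half hmatch hfull, add_mul, sum_add_distrib, ite_mul, zero_mul,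
          sum_ite_eq']
        simp

end Moments

section Instance

variable {A : Type*}

/-- In the chain, initial state and transitions force the state at time `t` to be `t`. -/
theorem chain_prob (n : ℕ) (τ : Fin (n + 1) → (Fin (n + 1) × A) × Bool) :
    (if (((τ 0).1.1 : Fin (n + 1)) : ℕ) = 0 then (1 : ℝ) else 0) *
      (∏ t : Fin (n + 1), if h : (t : ℕ) + 1 < n + 1 then
        (if (((τ ⟨(t : ℕ) + 1, h⟩).1.1 : Fin (n + 1)) : ℕ) =
          min (((τ t).1.1 : ℕ) + 1) (n + 1 - 1) then (1 : ℝ) else 0) else 1) =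
      if ∀ t, (τ t).1.1 = t then 1 else 0 := by
  split_ifs with h0 hall hall
  · rw [one_mul]
    refine prod_eq_one fun t _ => ?_
    split_ifs with h1 h2
    · rfl
    · exact absurd (by rw [hall, hall]; simp; omega) h2
    · rfl
  · rw [one_mul]
    by_contra hne
    refine hall fun t => ?_
    have key : ∀ j (hj : j < n + 1), ((τ ⟨j, hj⟩).1.1 : ℕ) = j := by
      intro j
      induction j with
      | zero => intro _; exact h0
      | succ j ih =>
        intro hj
        have := prod_ne_zero_iff.mp hne ⟨j, by omega⟩ (mem_univ _)
        simp only [hj, dite_true] at this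
        have h3 := (ite_ne_right_iff.mp this).1
        rw [ih (by omega)] at h3
        rw [h3]
        omega
    exact Fin.ext (key t t.2)
  · exact absurd (by rw [hall]; rfl) h0
  · rw [zero_mul]

/-- The history in which all correct actions were played and the rewards were `u`. -/
def correctHistory {n : ℕ} (astar : Fin (n + 1) → A) (u : Fin n → Bool) :
    List ((Fin (n + 1) × A) × Bool) :=
  List.ofFn fun i => ((i.castSucc, astar i.castSucc), u i)

/-- The probability that `π` plays all correct actions when the rewards are `u`. -/
def correctProb {n : ℕ} (astar : Fin (n + 1) → A)
    (π : List ((Fin (n + 1) × A) × Bool) → Fin (n + 1) → A → ℝ) (u : Fin n → Bool) : ℝ :=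
  ∏ t : Fin (n + 1), π ((correctHistory astar u).take t) t (astar t)

theorem correctProb_nonneg [Fintype A] {n : ℕ} (astar : Fin (n + 1) → A)
    {π : List ((Fin (n + 1) × A) × Bool) → Fin (n + 1) → A → ℝ} (hπ : IsPolicy π)
    (u : Fin n → Bool) : 0 ≤ correctProb astar π u :=
  prod_nonneg fun _ _ => (hπ _ _).1 _

theorem correctProb_le_one [Fintype A] {n : ℕ} (astar : Fin (n + 1) → A)
    {π : List ((Fin (n + 1) × A) × Bool) → Fin (n + 1) → A → ℝ} (hπ : IsPolicy π)
    (u : Fin n → Bool) : correctProb astar π u ≤ 1 :=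
  prod_le_one (fun _ _ => (hπ _ _).1 _) fun _ _ => (hπ _ _).2 ▸
    single_le_sum (f := fun a => π _ _ a) (fun a _ => (hπ _ _).1 a) (mem_univ _)

/-- Under fair-coin rewards every policy collects half of the rewards in expectation. -/
theorem sum_fair_reward [Fintype A] {n : ℕ}
    (π : List ((Fin (n + 1) × A) × Bool) → Fin (n + 1) → A → ℝ) (hπ : IsPolicy π) :
    ∑ τ : Fin (n + 1) → (Fin (n + 1) × A) × Bool,
      (if ∀ t, (τ t).1.1 = t then
        (∏ t : Fin (n + 1), π ((List.ofFn τ).take t) (τ t).1.1 (τ t).1.2) * (1 / 2 : ℝ) ^ (n + 1) else 0) *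
        ∑ t, (if (τ t).2 then (1 : ℝ) else 0) = ((n + 1 : ℕ) : ℝ) / 2 := by
  set k : List ((Fin (n + 1) × A) × Bool) → (Fin (n + 1) × A) × Bool → ℝ := fun h x =>
    (if x.1.1 = Fin.ofNat (n + 1) h.length then 1 else 0) * π h x.1.1 x.1.2 * (1 / 2) with hkdef
  have hk : ∀ h, ∑ x, k h x = 1 := by
    intro h
    simp only [hkdef, Fintype.sum_prod_type, Fintype.sum_bool, ite_mul, one_mul, zero_mul]
    simp_rw [← two_mul, ← mul_sum]
    rw [sum_comm]
    simp only [sum_ite_eq', mem_univ, if_true, ← sum_mul, (hπ _ _).2]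
    norm_num
  have hf : ∀ h, ∑ x, k h x * (if x.2 then (1 : ℝ) else 0) = 1 / 2 := by
    intro h
    simp only [hkdef, Fintype.sum_prod_type, Fintype.sum_bool, ite_mul, one_mul, zero_mul]
    rw [sum_comm]
    simp [← sum_mul, (hπ _ _).2]
  have := sum_prod_kernel_mul_sum (n + 1) k (fun x => if x.2 then (1 : ℝ) else 0) (1 / 2) hk hf
  rw [div_eq_mul_one_div ((n + 1 : ℕ) : ℝ) 2, ← this]
  refine sum_congr rfl fun τ _ => congrArg (· * _) ?_
  have hlen : ∀ t : Fin (n + 1),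
      Fin.ofNat (n + 1) ((List.ofFn τ).take t).length = t := by
    intro t
    ext
    simp
  simp only [hkdef, hlen, prod_mul_distrib, prod_const, card_univ, Fintype.card_fin]
  split_ifs with hs
  · simp [hs]
  · push Not at hs
    obtain ⟨t, ht⟩ := hs
    rw [prod_eq_zero (mem_univ t) (if_neg ht)]
    simp

variable [DecidableEq A]

/-- Sums over trajectories supported on correct actions are sums over reward sequences. -/
theorem sum_correct [Fintype A] {n : ℕ} (astar : Fin (n + 1) → A)
    (π : List ((Fin (n + 1) × A) × Bool) → Fin (n + 1) → A → ℝ)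
    (G : (Fin (n + 1) → Bool) → ℝ) :
    ∑ τ : Fin (n + 1) → (Fin (n + 1) × A) × Bool,
      (if (fun t => (τ t).1) = (fun t => (t, astar t)) then
        (∏ t : Fin (n + 1), π ((List.ofFn τ).take t) (τ t).1.1 (τ t).1.2) * G (fun t => (τ t).2) else 0) =
    ∑ u : Fin n → Bool, correctProb astar π u *
      (G (Fin.snoc u true) + G (Fin.snoc u false)) := by
  rw [← (Equiv.arrowProdEquivProdArrow (Fin (n + 1)) (fun _ => Fin (n + 1) × A)
    (fun _ => Bool)).symm.sum_comp, Fintype.sum_prod_type]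
  rw [sum_eq_single (fun t => (t, astar t))]
  · simp only [Equiv.arrowProdEquivProdArrow, Equiv.coe_fn_symm_mk, if_true]
    rw [← (Fin.snocEquiv fun _ => Bool).sum_comp, Fintype.sum_prod_type, sum_comm]
    refine sum_congr rfl fun u _ => ?_
    have hist : ∀ b : Bool, (∏ t : Fin (n + 1), π ((List.ofFn fun t : Fin (n + 1) =>
        ((t, astar t), (Fin.snoc u b : Fin (n + 1) → Bool) t)).take t) t (astar t)) =
        correctProb astar π u := by
      intro b
      refine prod_congr rfl fun t _ => ?_
      rw [List.ofFn_succ', List.concat_eq_append, List.take_append_of_le_length]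
      · simp [correctHistory]
      · simp; omega
    simp only [Fin.snocEquiv, Equiv.coe_fn_mk, Fintype.sum_bool]
    rw [hist, hist]
    ring
  · intro x _ hx
    refine sum_eq_zero fun r _ => if_neg ?_
    simpa [Equiv.arrowProdEquivProdArrow] using hx
  · simp

theorem trajProb_chain {n M : ℕ} {w : Fin M → ℝ} {μstar : Fin M → Fin (n + 1) → ℝ}
    (astar : Fin (n + 1) → A) {ε : ℝ}
    (hmatch : ∀ I : Finset (Fin (n + 1)), I ≠ univ →
      ∑ m, w m * ∏ t ∈ I, μstar m t = (1 / 2 : ℝ) ^ I.card)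
    (hfull : ∑ m, w m * ∏ t, μstar m t = (1 / 2 : ℝ) ^ (n + 1) + ε)
    {T : Fin (n + 1) × A → Fin (n + 1) → ℝ}
    (hT : T = fun (x : Fin (n + 1) × A) (s' : Fin (n + 1)) =>
      if (s' : ℕ) = min ((x.1 : ℕ) + 1) (n + 1 - 1) then (1 : ℝ) else 0)
    {ν : Fin (n + 1) → ℝ} (hν : ν = fun s : Fin (n + 1) => if (s : ℕ) = 0 then (1 : ℝ) else 0)
    {μ : Fin M → Fin (n + 1) × A → Bool → ℝ}
    (hμ : μ = fun (m : Fin M) (x : Fin (n + 1) × A) (r : Bool) =>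
      if r then (if x.2 = astar x.1 then μstar m x.1 else 1 / 2)
      else 1 - (if x.2 = astar x.1 then μstar m x.1 else 1 / 2))
    (π : List ((Fin (n + 1) × A) × Bool) → Fin (n + 1) → A → ℝ)
    (τ : Fin (n + 1) → (Fin (n + 1) × A) × Bool) :
    trajProb (n + 1) T ν π w μ τ =
      (if ∀ t, (τ t).1.1 = t then
        (∏ t : Fin (n + 1), π ((List.ofFn τ).take t) (τ t).1.1 (τ t).1.2) * (1 / 2 : ℝ) ^ (n + 1) else 0) +
      (if (fun t => (τ t).1) = (fun t => (t, astar t)) then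
        (∏ t : Fin (n + 1), π ((List.ofFn τ).take t) (τ t).1.1 (τ t).1.2) *
          (ε * ∏ t, rewardSign (τ t).2) else 0) := by
  have hchain := chain_prob n τ
  unfold trajProb
  subst hT hν
  rw [dif_pos n.succ_pos]
  erw [hchain]
  by_cases hs : ∀ t, (τ t).1.1 = t
  · have hmom : momentOn w μ (fun t => (τ t).1) (fun t => (τ t).2) univ =
        (1 / 2 : ℝ) ^ (n + 1) +
          ε * ∏ t, if (τ t).1.2 = astar t then rewardSign (τ t).2 else 0 := by
      rw [← sum_mul_prod_half_add n.succ_pos hmatch hfull, momentOn, hμ]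
      refine sum_congr rfl fun m _ => congrArg _ (prod_congr rfl fun t _ => ?_)
      simp only [hs]
      unfold rewardSign
      split_ifs <;> ring
    rw [hmom, if_pos hs, if_pos hs, one_mul, mul_add]
    congr 1
    split_ifs with hc
    · have : ∀ t, (τ t).1.2 = astar t := fun t => by rw [congrFun hc t]
      simp [this]
    · obtain ⟨t, ht⟩ : ∃ t, (τ t).1.2 ≠ astar t := by
        by_contra! h
        exact hc (funext fun t => Prod.ext (hs t) (h t))
      rw [prod_eq_zero (f := fun t => if (τ t).1.2 = astar t then rewardSign (τ t).2 else 0)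
        (mem_univ t) (if_neg ht)]
      simp
  · have hc : (fun t => (τ t).1) ≠ (fun t => (t, astar t)) :=
      fun h => hs fun t => by rw [congrFun h t]
    simp [hs, hc]

theorem sum_prod_rewardSign {n : ℕ} (hn : 0 < n) :
    ∑ u : Fin n → Bool, ∏ i, rewardSign (u i) = 0 := by
  have := (Finset.prod_univ_sum (fun _ : Fin n => (univ : Finset Bool))
    (fun _ b => rewardSign b)).symm
  rw [Fintype.piFinset_univ] at this
  rw [this]
  simp [rewardSign, hn.ne']

theorem prod_rewardSign_eq {n : ℕ} (u : Fin n → Bool) :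
    ∏ i, rewardSign (u i) = 1 ∨ ∏ i, rewardSign (u i) = -1 := by
  induction n with
  | zero => simp
  | succ n ih =>
    rw [Fin.prod_univ_succ]
    rcases ih (fun i => u i.succ) with h | h <;> rw [h] <;> cases u 0 <;> simp [rewardSign]

/-- The policy playing the correct action, except that in the last step it plays `b`
after an odd number of zero rewards. -/
noncomputable def parityPolicy {n : ℕ} (astar : Fin (n + 1) → A) (b : A) :
    List ((Fin (n + 1) × A) × Bool) → Fin (n + 1) → A → ℝ := fun h s a =>
  if a = (if s = Fin.last n ∧ (h.map fun x => rewardSign x.2).prod ≠ 1 then b else astar s)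
  then 1 else 0

theorem isPolicy_parityPolicy [Fintype A] {n : ℕ} (astar : Fin (n + 1) → A) (b : A) :
    IsPolicy (parityPolicy astar b) := by
  intro h s
  refine ⟨fun a => ?_, ?_⟩
  · unfold parityPolicy
    split_ifs <;> norm_num
  · simp [parityPolicy]

theorem correctProb_parityPolicy {n : ℕ} (astar : Fin (n + 1) → A) {b : A}
    (hb : b ≠ astar (Fin.last n)) (u : Fin n → Bool) :
    correctProb astar (parityPolicy astar b) u =
      if ∏ i, rewardSign (u i) = 1 then 1 else 0 := by
  have hlast : (((correctHistory astar u).take n).map fun x => rewardSign x.2).prod =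
      ∏ i, rewardSign (u i) := by
    rw [List.take_of_length_le (by simp [correctHistory]), correctHistory, List.map_ofFn,
      List.prod_ofFn]
    rfl
  rw [correctProb, Fin.prod_univ_castSucc, prod_eq_one, one_mul]
  · simp only [parityPolicy, Fin.val_last, hlast, true_and]
    by_cases h : ∏ i, rewardSign (u i) = 1 <;> simp [h, hb.symm]
  · intro t _
    simp [parityPolicy, (Fin.castSucc_lt_last t).ne]

theorem sum_correctProb_parityPolicy {n : ℕ} (hn : 0 < n) (astar : Fin (n + 1) → A) {b : A}
    (hb : b ≠ astar (Fin.last n)) :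
    ∑ u, correctProb astar (parityPolicy astar b) u * ∏ i, rewardSign (u i) = 2 ^ (n - 1) := by
  have hterm : ∀ u : Fin n → Bool,
      correctProb astar (parityPolicy astar b) u * ∏ i, rewardSign (u i) =
        1 / 2 + 1 / 2 * ∏ i, rewardSign (u i) := by
    intro u
    rw [correctProb_parityPolicy astar hb]
    rcases prod_rewardSign_eq u with h | h <;> rw [h] <;> norm_num
  simp_rw [hterm, sum_add_distrib, ← mul_sum]
  rw [sum_prod_rewardSign hn]
  obtain ⟨k, rfl⟩ : ∃ k, n = k + 1 := ⟨n - 1, by omega⟩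
  simp [pow_succ]

/-- The value of a policy in the hard instance. -/
theorem cumReward_chain [Fintype A] {n M : ℕ} {w : Fin M → ℝ}
    {μstar : Fin M → Fin (n + 1) → ℝ} (astar : Fin (n + 1) → A) {ε : ℝ}
    (hmatch : ∀ I : Finset (Fin (n + 1)), I ≠ univ →
      ∑ m, w m * ∏ t ∈ I, μstar m t = (1 / 2 : ℝ) ^ I.card)
    (hfull : ∑ m, w m * ∏ t, μstar m t = (1 / 2 : ℝ) ^ (n + 1) + ε)
    {T : Fin (n + 1) × A → Fin (n + 1) → ℝ}
    (hT : T = fun (x : Fin (n + 1) × A) (s' : Fin (n + 1)) =>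
      if (s' : ℕ) = min ((x.1 : ℕ) + 1) (n + 1 - 1) then (1 : ℝ) else 0)
    {ν : Fin (n + 1) → ℝ} (hν : ν = fun s : Fin (n + 1) => if (s : ℕ) = 0 then (1 : ℝ) else 0)
    {μ : Fin M → Fin (n + 1) × A → Bool → ℝ}
    (hμ : μ = fun (m : Fin M) (x : Fin (n + 1) × A) (r : Bool) =>
      if r then (if x.2 = astar x.1 then μstar m x.1 else 1 / 2)
      else 1 - (if x.2 = astar x.1 then μstar m x.1 else 1 / 2))
    (π : List ((Fin (n + 1) × A) × Bool) → Fin (n + 1) → A → ℝ) (hπ : IsPolicy π) :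
    cumReward (n + 1) T ν π w μ = ((n + 1 : ℕ) : ℝ) / 2 +
      ε * ∑ u, correctProb astar π u * ∏ i, rewardSign (u i) := by
  simp_rw [cumReward, trajProb_chain astar hmatch hfull hT hν hμ, add_mul, sum_add_distrib]
  rw [sum_fair_reward π hπ]
  congr 1
  simp_rw [ite_mul, zero_mul, mul_assoc]
  rw [sum_correct astar π fun r =>
    ε * ((∏ t, rewardSign (r t)) * ∑ t, if r t then (1 : ℝ) else 0), mul_sum]
  refine sum_congr rfl fun u _ => ?_
  simp only [Fin.prod_univ_castSucc, Fin.sum_univ_castSucc, Fin.snoc_castSucc, Fin.snoc_last]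
  simp only [rewardSign, if_true, Bool.false_eq_true, if_false]
  ring

/-- The probability of playing all correct actions in the hard instance. -/
theorem eventProb_correct_chain [Fintype A] {n M : ℕ} {w : Fin M → ℝ}
    {μstar : Fin M → Fin (n + 1) → ℝ} (astar : Fin (n + 1) → A) {ε : ℝ}
    (hmatch : ∀ I : Finset (Fin (n + 1)), I ≠ univ →
      ∑ m, w m * ∏ t ∈ I, μstar m t = (1 / 2 : ℝ) ^ I.card)
    (hfull : ∑ m, w m * ∏ t, μstar m t = (1 / 2 : ℝ) ^ (n + 1) + ε)
    {T : Fin (n + 1) × A → Fin (n + 1) → ℝ}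
    (hT : T = fun (x : Fin (n + 1) × A) (s' : Fin (n + 1)) =>
      if (s' : ℕ) = min ((x.1 : ℕ) + 1) (n + 1 - 1) then (1 : ℝ) else 0)
    {ν : Fin (n + 1) → ℝ} (hν : ν = fun s : Fin (n + 1) => if (s : ℕ) = 0 then (1 : ℝ) else 0)
    {μ : Fin M → Fin (n + 1) × A → Bool → ℝ}
    (hμ : μ = fun (m : Fin M) (x : Fin (n + 1) × A) (r : Bool) =>
      if r then (if x.2 = astar x.1 then μstar m x.1 else 1 / 2)
      else 1 - (if x.2 = astar x.1 then μstar m x.1 else 1 / 2))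
    (π : List ((Fin (n + 1) × A) × Bool) → Fin (n + 1) → A → ℝ) :
    (∑ τ : Fin (n + 1) → (Fin (n + 1) × A) × Bool,
      if ∀ t, (τ t).1.2 = astar t then trajProb (n + 1) T ν π w μ τ else 0) =
      (1 / 2 : ℝ) ^ n * ∑ u, correctProb astar π u := by
  have hterm : ∀ τ : Fin (n + 1) → (Fin (n + 1) × A) × Bool,
      (if ∀ t, (τ t).1.2 = astar t then trajProb (n + 1) T ν π w μ τ else 0) =
      if (fun t => (τ t).1) = (fun t => (t, astar t)) then
        (∏ t : Fin (n + 1), π ((List.ofFn τ).take t) (τ t).1.1 (τ t).1.2) *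
          ((1 / 2 : ℝ) ^ (n + 1) + ε * ∏ t, rewardSign (τ t).2) else 0 := by
    intro τ
    rw [trajProb_chain astar hmatch hfull hT hν hμ]
    have hiff : (fun t => (τ t).1) = (fun t => (t, astar t)) ↔
        (∀ t, (τ t).1.2 = astar t) ∧ ∀ t, (τ t).1.1 = t := by
      simp only [funext_iff, Prod.ext_iff, forall_and]
      exact and_comm
    by_cases ha : ∀ t, (τ t).1.2 = astar t <;> by_cases hs : ∀ t, (τ t).1.1 = t
    · rw [if_pos ha, if_pos hs, if_pos (hiff.mpr ⟨ha, hs⟩), if_pos (hiff.mpr ⟨ha, hs⟩), mul_add]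
    · rw [if_pos ha, if_neg hs, if_neg (mt hiff.mp fun h => hs h.2),
        if_neg (mt hiff.mp fun h => hs h.2), add_zero]
    all_goals rw [if_neg ha, if_neg (mt hiff.mp fun h => ha h.1)]
  simp_rw [hterm]
  rw [sum_correct astar π fun r => (1 / 2 : ℝ) ^ (n + 1) + ε * ∏ t, rewardSign (r t), mul_sum]
  refine sum_congr rfl fun u _ => ?_
  simp only [Fin.prod_univ_castSucc, Fin.snoc_castSucc, Fin.snoc_last]
  simp only [rewardSign, if_true, Bool.false_eq_true, if_false]
  ring

end Instance

/-- Lemma: optimal value and behaviour of near-optimal policies in the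
hard lower-bound instance.  States are `Fin d` with deterministic transition `t → t+1`,
initial state `0`, rewards in `{0,1}`; the action `a*_t` yields success probability
`μ*_m(t)` in context `m`, every other action yields a fair coin.  Under the
moment-matching hypotheses, (a) the optimal value is at least `d/2 + ε·2^{d−2}`, and
(b) any `ε`-optimal history-dependent policy plays the correct action sequence with
probability at least `1/4`. -/
theorem statement7 {A : Type*} [Fintype A] [DecidableEq A]
    (hA : 2 ≤ Fintype.card A)
    (d : ℕ) (hd : 4 < d) {M : ℕ}
    (w : Fin M → ℝ) (hw : IsDist w)
    (μstar : Fin M → Fin d → ℝ) (hμs : ∀ m t, μstar m t ∈ Set.Icc (0 : ℝ) 1)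
    (astar : Fin d → A)
    (ε : ℝ) (hε : 0 < ε) (hε' : ε ≤ 1 / (2 * d : ℝ) ^ (2 * d))
    (hmatch : ∀ I : Finset (Fin d), I ≠ Finset.univ →
      ∑ m, w m * ∏ t ∈ I, μstar m t = (1 / 2 : ℝ) ^ I.card)
    (hfull : ∑ m, w m * ∏ t, μstar m t = (1 / 2 : ℝ) ^ d + ε)
    (T : Fin d × A → Fin d → ℝ)
    (hT : T = fun (x : Fin d × A) (s' : Fin d) =>
      if (s' : ℕ) = min ((x.1 : ℕ) + 1) (d - 1) then (1 : ℝ) else 0)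
    (ν : Fin d → ℝ) (hν : ν = fun s : Fin d => if (s : ℕ) = 0 then (1 : ℝ) else 0)
    (μ : Fin M → Fin d × A → Bool → ℝ)
    (hμ : μ = fun (m : Fin M) (x : Fin d × A) (r : Bool) =>
      if r then (if x.2 = astar x.1 then μstar m x.1 else 1 / 2)
      else 1 - (if x.2 = astar x.1 then μstar m x.1 else 1 / 2))
    (Vopt : ℝ)
    (hV : Vopt = ⨆ π : {p : List ((Fin d × A) × Bool) → Fin d → A → ℝ // IsPolicy p},
      cumReward d T ν π.1 w μ) :
    ((d : ℝ) / 2 + ε * 2 ^ (d - 2) ≤ Vopt) ∧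
    (∀ π : List ((Fin d × A) × Bool) → Fin d → A → ℝ, IsPolicy π →
      Vopt - ε ≤ cumReward d T ν π w μ →
      (1 / 4 : ℝ) ≤ ∑ τ : Fin d → (Fin d × A) × Bool,
        if ∀ t, (τ t).1.2 = astar t then trajProb d T ν π w μ τ else 0) := by
  obtain ⟨n, rfl⟩ : ∃ n, d = n + 1 := ⟨d - 1, by omega⟩
  have hval := fun π hπ => cumReward_chain astar hmatch hfull hT hν hμ π hπ
  have hprob := eventProb_correct_chain astar hmatch hfull hT hν hμ
  have hsum_le : ∀ π, IsPolicy π →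
      ∑ u, correctProb astar π u * ∏ i, rewardSign (u i) ≤ ∑ u, correctProb astar π u := by
    refine fun π hπ => sum_le_sum fun u _ => ?_
    have hnn := correctProb_nonneg astar hπ u
    rcases prod_rewardSign_eq u with h | h <;> rw [h] <;> linarith
  have hbdd : BddAbove (Set.range fun π :
      {p : List ((Fin (n + 1) × A) × Bool) → Fin (n + 1) → A → ℝ // IsPolicy p} =>
      cumReward (n + 1) T ν π.1 w μ) := by
    refine ⟨((n + 1 : ℕ) : ℝ) / 2 + ε * ∑ _u : Fin n → Bool, 1, ?_⟩
    rintro _ ⟨⟨π, hπ⟩, rfl⟩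
    dsimp only
    rw [hval π hπ]
    refine add_le_add_right (mul_le_mul_of_nonneg_left ?_ hε.le) _
    exact (hsum_le π hπ).trans (sum_le_sum fun u _ => correctProb_le_one astar hπ u)
  have hopt : ((n + 1 : ℕ) : ℝ) / 2 + ε * 2 ^ (n + 1 - 2) ≤ Vopt := by
    have : Nontrivial A := Fintype.one_lt_card_iff_nontrivial.mp hA
    obtain ⟨b, hb⟩ := exists_ne (astar (Fin.last n))
    have h := le_ciSup hbdd ⟨parityPolicy astar b, isPolicy_parityPolicy astar b⟩
    rw [← hV] at h
    dsimp only at h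
    rw [hval _ (isPolicy_parityPolicy astar b),
      sum_correctProb_parityPolicy (by omega) astar hb] at h
    exact h
  refine ⟨hopt, fun π hπ hnear => ?_⟩
  rw [hprob π]
  have hcum := hval π hπ
  have hlow : (2 : ℝ) ^ (n + 1 - 2) - 1 ≤ ∑ u, correctProb astar π u := by
    refine le_trans (le_of_mul_le_mul_left ?_ hε) (hsum_le π hπ)
    linarith
  obtain ⟨k, rfl⟩ : ∃ k, n = k + 2 := ⟨n - 2, by omega⟩
  have hk : (1 : ℝ) ≤ 2 ^ k := one_le_pow₀ (by norm_num)
  rw [show k + 2 + 1 - 2 = k + 1 by omega] at hlow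
  rw [one_div_pow, one_div_mul_eq_div, le_div_iff₀ (by positivity)]
  refine le_trans ?_ hlow
  rw [pow_add, pow_succ (2 : ℝ) k]
  linarith
end

section
/- Let w₁,…,w_M ≥ 0 with Σ_m w_m = 1 and μ*₁,…,μ*_M ∈ [0,1]^d satisfy: for every proper I ⊊ {1,…,d}, Σ_m w_m Π_{t∈I} μ*_m(t) = (1/2)^{|I|}, and Σ_m w_m Π_{t=1}^d μ*_m(t) = (1/2)^d + ε, where ε₀ := ε·2^{d−1} satisfies 0 < ε₀ < 1/2. Let P₂ be the mixture distribution on {0,1}^d with P₂(r) := Σ_m w_m Π_{t=1}^d b(μ*_m(t), r_t), and let P₁ be the uniform distribution on {0,1}^d. Then KL(P₁, P₂) = −(1/2)·ln(1 − 4ε₀²); in particular KL(P₁, P₂) ≤ 4ε₀² whenever ε₀ ≤ 1/4. -/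
open Finset

/-- KL divergence between two nonnegative functions on a finite type, with the
convention `0 · log(0/·) = 0`. -/
noncomputable def klFin {Ω : Type*} [Fintype Ω] (p q : Ω → ℝ) : ℝ :=
  ∑ ω, if p ω = 0 then 0 else p ω * Real.log (p ω / q ω)

/-- The sign `1` for `true` and `-1` for `false`. -/
def boolSign (r : Bool) : ℝ := if r then 1 else -1

lemma bfun_eq_boolSign_mul_add (p : ℝ) (r : Bool) :
    bfun p r = boolSign r * p + (if r then 0 else 1) := by
  cases r <;> simp [bfun, boolSign]
  ring

lemma prod_boolSign_eq_one_or {ι : Type*} (s : Finset ι) (r : ι → Bool) :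
    ∏ t ∈ s, boolSign (r t) = 1 ∨ ∏ t ∈ s, boolSign (r t) = -1 := by
  refine Finset.prod_induction (fun t => boolSign (r t)) (fun x => x = 1 ∨ x = -1) ?_ (by simp) ?_
  · rintro a b (rfl | rfl) (rfl | rfl) <;> simp
  · intro t _
    cases r t <;> simp [boolSign]

lemma sum_prod_boolSign {ι : Type*} [Fintype ι] [DecidableEq ι] [Nonempty ι] :
    ∑ r : ι → Bool, ∏ t, boolSign (r t) = 0 := by
  rw [← Fintype.prod_sum (fun (_ : ι) => boolSign)]
  simp [boolSign]

/-- Expansion of a mixture of product Bernoulli distributions in its moments. -/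
lemma sum_mul_prod_bfun {ι κ : Type*} [Fintype ι] [DecidableEq ι] [Fintype κ]
    (w : κ → ℝ) (p : κ → ι → ℝ) (r : ι → Bool) :
    ∑ m, w m * ∏ t, bfun (p m t) (r t) =
      ∑ I : Finset ι, ((∏ t ∈ I, boolSign (r t)) * ∏ t ∈ univ \ I, if r t then (0 : ℝ) else 1) *
        ∑ m, w m * ∏ t ∈ I, p m t := by
  simp_rw [bfun_eq_boolSign_mul_add, Finset.prod_add, Finset.powerset_univ, Finset.mul_sum]
  rw [Finset.sum_comm]
  refine Finset.sum_congr rfl fun I _ => Finset.sum_congr rfl fun m _ => ?_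
  rw [Finset.prod_mul_distrib]
  ring

/-- A mixture whose proper moments are those of the uniform distribution differs from it only by
the parity character. -/
lemma sum_mul_prod_bfun_of_moments {ι κ : Type*} [Fintype ι] [DecidableEq ι] [Fintype κ]
    (w : κ → ℝ) (p : κ → ι → ℝ) (ε : ℝ)
    (hmatch : ∀ I : Finset ι, I ≠ univ → ∑ m, w m * ∏ t ∈ I, p m t = (1 / 2 : ℝ) ^ I.card)
    (hfull : ∑ m, w m * ∏ t, p m t = (1 / 2 : ℝ) ^ Fintype.card ι + ε) (r : ι → Bool) :
    ∑ m, w m * ∏ t, bfun (p m t) (r t) =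
      (1 / 2 : ℝ) ^ Fintype.card ι + (∏ t, boolSign (r t)) * ε := by
  have hmoment : ∀ I : Finset ι, ∑ m, w m * ∏ t ∈ I, p m t =
      (1 / 2 : ℝ) ^ I.card + if I = univ then ε else 0 := by
    intro I
    split_ifs with h
    · subst h
      simpa using hfull
    · simpa using hmatch I h
  have huniform := sum_mul_prod_bfun (fun _ : Unit => 1) (fun _ (_ : ι) => (1 / 2 : ℝ)) r
  have hhalf : ∀ b : Bool, bfun (1 / 2) b = 1 / 2 := by
    intro b
    cases b <;> norm_num [bfun]
  simp only [hhalf, Finset.univ_unique, Finset.sum_singleton, one_mul, Finset.prod_const,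
    Finset.card_univ] at huniform
  rw [sum_mul_prod_bfun, huniform]
  simp_rw [hmoment, mul_add, Finset.sum_add_distrib]
  simp

/-- KL divergence between the uniform model and the hard moment-matching
mixture.  With `ε₀ = ε·2^{d−1} ∈ (0, 1/2)`, the KL divergence from the uniform
distribution `P₁` on `{0,1}^d` to the mixture `P₂` equals `−(1/2)·ln(1 − 4ε₀²)`; in
particular it is at most `4ε₀²` whenever `ε₀ ≤ 1/4`. -/
theorem statement9 (d : ℕ) (hd : 0 < d) {M : ℕ}
    (w : Fin M → ℝ) (hw : IsDist w)
    (μstar : Fin M → Fin d → ℝ) (hμ : ∀ m t, μstar m t ∈ Set.Icc (0 : ℝ) 1)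
    (ε : ℝ)
    (hmatch : ∀ I : Finset (Fin d), I ≠ Finset.univ →
      ∑ m, w m * ∏ t ∈ I, μstar m t = (1 / 2 : ℝ) ^ I.card)
    (hfull : ∑ m, w m * ∏ t, μstar m t = (1 / 2 : ℝ) ^ d + ε)
    (ε₀ : ℝ) (hε₀ : ε₀ = ε * 2 ^ (d - 1))
    (h1 : 0 < ε₀) (h2 : ε₀ < 1 / 2) :
    klFin (fun _ : Fin d → Bool => (1 / 2 : ℝ) ^ d)
        (fun r : Fin d → Bool => ∑ m, w m * ∏ t, bfun (μstar m t) (r t))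
      = -(1 / 2) * Real.log (1 - 4 * ε₀ ^ 2) ∧
    (ε₀ ≤ 1 / 4 →
      klFin (fun _ : Fin d → Bool => (1 / 2 : ℝ) ^ d)
          (fun r : Fin d → Bool => ∑ m, w m * ∏ t, bfun (μstar m t) (r t))
        ≤ 4 * ε₀ ^ 2) := by
  have hP₂ : ∀ r : Fin d → Bool, ∑ m, w m * ∏ t, bfun (μstar m t) (r t) =
      (1 / 2 : ℝ) ^ d + (∏ t, boolSign (r t)) * ε := fun r => by
    simpa using sum_mul_prod_bfun_of_moments w μstar ε hmatch (by simpa using hfull) r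
  have hε : ε = (1 / 2 : ℝ) ^ d * (2 * ε₀) := by
    obtain ⟨n, rfl⟩ := Nat.exists_eq_succ_of_ne_zero hd.ne'
    rw [hε₀, Nat.succ_sub_one, pow_succ, one_div, inv_pow]
    field_simp
  have hhalf : (1 / 2 : ℝ) ^ d ≠ 0 := by positivity
  have hplus : 0 < 1 + 2 * ε₀ := by linarith
  have hminus : 0 < 1 - 2 * ε₀ := by linarith
  have hlog : Real.log (1 - 4 * ε₀ ^ 2) = Real.log (1 + 2 * ε₀) + Real.log (1 - 2 * ε₀) := by
    rw [← Real.log_mul hplus.ne' hminus.ne']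
    ring_nf
  have hterm : ∀ r : Fin d → Bool,
      (1 / 2 : ℝ) ^ d * Real.log ((1 / 2 : ℝ) ^ d / ((1 / 2 : ℝ) ^ d + (∏ t, boolSign (r t)) * ε)) =
        (1 / 2 : ℝ) ^ d * (-(1 / 2) * Real.log (1 - 4 * ε₀ ^ 2)) +
        (∏ t, boolSign (r t)) *
          ((1 / 2 : ℝ) ^ d * ((Real.log (1 - 2 * ε₀) - Real.log (1 + 2 * ε₀)) / 2)) := by
    intro r
    have hratio : ∀ s : ℝ, (1 / 2 : ℝ) ^ d / ((1 / 2 : ℝ) ^ d + s * ε) = (1 + s * (2 * ε₀))⁻¹ := by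
      intro s
      rw [hε, show (1 / 2 : ℝ) ^ d + s * ((1 / 2 : ℝ) ^ d * (2 * ε₀)) =
        (1 / 2 : ℝ) ^ d * (1 + s * (2 * ε₀)) by ring, div_mul_cancel_left₀ hhalf]
    rw [hratio, Real.log_inv, hlog]
    rcases prod_boolSign_eq_one_or univ r with h | h <;> rw [h]
    · rw [one_mul]
      ring
    · rw [neg_one_mul, ← sub_eq_add_neg]
      ring
  have hkl : klFin (fun _ : Fin d → Bool => (1 / 2 : ℝ) ^ d)
      (fun r : Fin d → Bool => ∑ m, w m * ∏ t, bfun (μstar m t) (r t))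
      = -(1 / 2) * Real.log (1 - 4 * ε₀ ^ 2) := by
    have : Nonempty (Fin d) := ⟨⟨0, hd⟩⟩
    simp only [klFin, if_neg hhalf, hP₂, hterm]
    rw [Finset.sum_add_distrib, ← Finset.sum_mul, ← Finset.sum_mul, sum_prod_boolSign, zero_mul,
      add_zero, Finset.sum_const, Finset.card_univ, Fintype.card_fun, Fintype.card_bool,
      Fintype.card_fin, nsmul_eq_mul, Nat.cast_pow, Nat.cast_ofNat, ← mul_pow]
    norm_num
  refine ⟨hkl, fun h4 => ?_⟩
  rw [hkl]
  have hpos : 0 < 1 - 4 * ε₀ ^ 2 := by nlinarith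
  have hbound := Real.one_sub_inv_le_log_of_pos hpos
  have hinv : (1 - 4 * ε₀ ^ 2)⁻¹ ≤ 1 + 8 * ε₀ ^ 2 := by
    rw [inv_le_iff_one_le_mul₀ hpos]
    have hsq : ε₀ ^ 2 ≤ 1 / 16 := by nlinarith
    nlinarith [mul_nonneg (sq_nonneg ε₀) (sub_nonneg.2 hsq)]
  linarith
end
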